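/- arXiv:2507.05606 — 14 statements merged into one kernel-verified Lean document; each statement's English description precedes it below -/
import Mathlib

section
/- Fix n ≥ 1, revenues r_i > 0 and MNL preference weights v_i > 0 for i ∈ {1,…,n}, and a balancing parameter α ∈ (0,1]. Then the optimal value R* of the randomized balanced-market-share problem BMS satisfies R* ≤ n · R*_det, where R*_det is the optimal value of the deterministic balanced-market-share problem. -/
open Classical Finset

noncomputable section

/-- A vector `(x0, x)` is BMS-feasible: probabilities sum to one, each purchase
probability is between `0` and `v i * x0`, and each coordinate is either zero
or at least `α` times the maximum coordinate. -/
def BMSFeasible (n : ℕ) (v : Fin n → ℝ) (α : ℝ) (x0 : ℝ) (x : Fin n → ℝ) : Prop :=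
  x0 + ∑ i, x i = 1 ∧
  (∀ i, 0 ≤ x i ∧ x i ≤ v i * x0) ∧
  (∀ i, x i = 0 ∨ ∀ j, α * x j ≤ x i)

/-- Optimal value of the randomized balanced-market-share problem BMS. -/
def Rstar (n : ℕ) (r v : Fin n → ℝ) (α : ℝ) : ℝ :=
  sSup {R | ∃ x0 x, BMSFeasible n v α x0 x ∧ ∑ i, r i * x i = R}

/-- An assortment `S` is deterministically feasible for the market share
balancing constraint: preference weights of offered products differ by at most
a factor of `α`. -/
def DetFeasible (n : ℕ) (v : Fin n → ℝ) (α : ℝ) (S : Finset (Fin n)) : Prop :=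
  ∀ i ∈ S, ∀ j ∈ S, α * v j ≤ v i

/-- Expected revenue of assortment `S` under the MNL model. -/
def assortRev (n : ℕ) (r v : Fin n → ℝ) (S : Finset (Fin n)) : ℝ :=
  (∑ i ∈ S, r i * v i) / (1 + ∑ i ∈ S, v i)

/-- Optimal value of the deterministic balanced-market-share problem. -/
def RstarDet (n : ℕ) (r v : Fin n → ℝ) (α : ℝ) : ℝ :=
  sSup {R | ∃ S : Finset (Fin n), DetFeasible n v α S ∧ assortRev n r v S = R}

/-- A market share is at most the one the product attains when offered alone. -/
theorem BMSFeasible.le_div {n : ℕ} {v : Fin n → ℝ} {α x0 : ℝ} {x : Fin n → ℝ}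
    (hv : ∀ i, 0 < v i) (h : BMSFeasible n v α x0 x) (i : Fin n) :
    x i ≤ v i / (1 + v i) := by
  obtain ⟨hsum, hbd, -⟩ := h
  have hle : x i ≤ ∑ j, x j :=
    Finset.single_le_sum (fun j _ => (hbd j).1) (Finset.mem_univ i)
  have hvi := hv i
  rw [le_div_iff₀ (by linarith)]
  have hmul : v i * x0 ≤ v i * (1 - x i) :=
    mul_le_mul_of_nonneg_left (by linarith) hvi.le
  linarith [(hbd i).2]

/-- Every deterministically feasible assortment earns at most the optimal value. -/
theorem assortRev_le_RstarDet {n : ℕ} {r v : Fin n → ℝ} {α : ℝ} {S : Finset (Fin n)}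
    (hS : DetFeasible n v α S) : assortRev n r v S ≤ RstarDet n r v α := by
  refine le_csSup (Set.Finite.bddAbove ?_) ⟨S, hS, rfl⟩
  refine (Set.finite_range (assortRev n r v)).subset ?_
  rintro R ⟨T, -, rfl⟩
  exact ⟨T, rfl⟩

theorem DetFeasible.singleton {n : ℕ} {v : Fin n → ℝ} {α : ℝ}
    (hv : ∀ i, 0 < v i) (hα : α ≤ 1) (i : Fin n) : DetFeasible n v α {i} := by
  intro j hj k hk
  rw [Finset.mem_singleton] at hj hk
  subst hj hk
  exact mul_le_of_le_one_left (hv _).le hα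

theorem DetFeasible.empty {n : ℕ} {v : Fin n → ℝ} {α : ℝ} : DetFeasible n v α ∅ := by
  intro i hi
  simp at hi

theorem RstarDet_nonneg {n : ℕ} {r v : Fin n → ℝ} {α : ℝ} : 0 ≤ RstarDet n r v α := by
  simpa [assortRev] using assortRev_le_RstarDet (r := r) (DetFeasible.empty (v := v) (α := α))

/-- the optimal randomized value is at most `n` times the optimal
deterministic value. -/
theorem stmt_0 (n : ℕ) (hn : 1 ≤ n) (r v : Fin n → ℝ)
    (hr : ∀ i, 0 < r i) (hv : ∀ i, 0 < v i)
    (α : ℝ) (hα0 : 0 < α) (hα1 : α ≤ 1) :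
    Rstar n r v α ≤ (n : ℝ) * RstarDet n r v α := by
  refine Real.sSup_le ?_ (mul_nonneg n.cast_nonneg RstarDet_nonneg)
  rintro R ⟨x0, x, hx, rfl⟩
  have hterm : ∀ i ∈ Finset.univ, r i * x i ≤ RstarDet n r v α := fun i _ =>
    calc r i * x i ≤ r i * (v i / (1 + v i)) :=
          mul_le_mul_of_nonneg_left (hx.le_div hv i) (hr i).le
      _ = assortRev n r v {i} := by simp [assortRev, mul_div_assoc]
      _ ≤ RstarDet n r v α := assortRev_le_RstarDet (DetFeasible.singleton hv hα1 i)
  simpa using Finset.sum_le_card_nsmul _ _ _ hterm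
end
end

section
/- For every integer n ≥ 1 and every balancing parameter α ∈ (0,1], there exist revenues r_i > 0 and MNL preference weights v_i > 0 for i ∈ {1,…,n} such that the optimal value R* of the randomized balanced-market-share problem BMS and the optimal value R*_det of the deterministic balanced-market-share problem satisfy: either R* ≥ (n/2)·R*_det, or α < 1 and 2(1−α)·R* ≥ R*_det. (Equivalently, R* ≥ min{1/(2(1−α)), n/2}·R*_det, with the convention that 1/(2(1−α)) = +∞ when α = 1.) -/
open Classical Finset

noncomputable section

/-- If every deterministically feasible assortment is a subsingleton and `r i * v i = 1`, the
deterministic optimum is at most one. -/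
lemma RstarDet_le_one {n : ℕ} {r v : Fin n → ℝ} {α : ℝ} (hv : ∀ i, 0 < v i)
    (hrv : ∀ i, r i * v i = 1)
    (hS : ∀ S : Finset (Fin n), DetFeasible n v α S → ∀ i ∈ S, ∀ j ∈ S, i = j) :
    RstarDet n r v α ≤ 1 := by
  apply Real.sSup_le _ zero_le_one
  rintro _ ⟨S, hfeas, rfl⟩
  have hcard : (S.card : ℝ) ≤ 1 := by
    exact_mod_cast Finset.card_le_one.2 (hS S hfeas)
  have hsum : 0 ≤ ∑ i ∈ S, v i := Finset.sum_nonneg fun i _ => (hv i).le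
  unfold assortRev
  rw [div_le_one (by linarith), Finset.sum_congr rfl fun i _ => hrv i]
  simp only [Finset.sum_const, nsmul_eq_mul, mul_one]
  linarith

/-- The value of a feasible vector is at most `Rstar`. -/
lemma le_Rstar {n : ℕ} {r v : Fin n → ℝ} {α x0 : ℝ} {x : Fin n → ℝ} (hr : ∀ i, 0 < r i)
    (hv : ∀ i, 0 < v i) (hx : BMSFeasible n v α x0 x) :
    ∑ i, r i * x i ≤ Rstar n r v α := by
  refine le_csSup ⟨∑ i, r i * v i, ?_⟩ ⟨x0, x, hx, rfl⟩
  rintro _ ⟨y0, y, ⟨hsum, hbd, -⟩, rfl⟩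
  have hy0 : y0 ≤ 1 := by
    have : 0 ≤ ∑ i, y i := Finset.sum_nonneg fun i _ => (hbd i).1
    linarith
  refine Finset.sum_le_sum fun i _ => mul_le_mul_of_nonneg_left ?_ (hr i).le
  exact (hbd i).2.trans (mul_le_of_le_one_right (hv i).le hy0)

/-- Geometric weights make only singletons deterministically feasible. -/
lemma eq_of_detFeasible_geometric {n : ℕ} {α β c : ℝ} (hβ0 : 0 < β) (hβα : β < α) (hα1 : α ≤ 1)
    (hc : 0 < c) {S : Finset (Fin n)} (hS : DetFeasible n (fun i => c / β ^ (i : ℕ)) α S) :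
    ∀ i ∈ S, ∀ j ∈ S, i = j := by
  have hnlt : ∀ i ∈ S, ∀ j ∈ S, ¬ i < j := by
    intro i hi j hj hij
    have h : α * (c / β ^ (j : ℕ)) ≤ c / β ^ (i : ℕ) := hS i hi j hj
    have hpow : β ^ (j : ℕ) ≤ β * β ^ (i : ℕ) := by
      rw [← pow_succ']
      exact pow_le_pow_of_le_one hβ0.le (hβα.le.trans hα1) hij
    have hi0 : 0 < β ^ (i : ℕ) := pow_pos hβ0 _
    have hj0 : 0 < β ^ (j : ℕ) := pow_pos hβ0 _
    rw [← mul_div_assoc, div_le_div_iff₀ hj0 hi0] at h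
    have h1 : c * β ^ (j : ℕ) ≤ c * (β * β ^ (i : ℕ)) := mul_le_mul_of_nonneg_left hpow hc.le
    have h2 : 0 < (α - β) * (c * β ^ (i : ℕ)) := mul_pos (sub_pos.2 hβα) (mul_pos hc hi0)
    linarith
  intro i hi j hj
  exact le_antisymm (not_lt.1 (hnlt j hj i hi)) (not_lt.1 (hnlt i hi j hj))

/-- Any factor strictly below the geometric sum `∑ i < n, α ^ i` is gained by randomization on
some instance. -/
lemma exists_instance_of_lt_geom_sum {n : ℕ} {α M : ℝ} (hα0 : 0 < α) (hα1 : α ≤ 1) (hM : 0 < M)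
    (hMα : M < ∑ i : Fin n, α ^ (i : ℕ)) :
    ∃ r v : Fin n → ℝ, (∀ i, 0 < r i) ∧ (∀ i, 0 < v i) ∧
      M * RstarDet n r v α ≤ Rstar n r v α := by
  obtain ⟨β, hMβ, hβ0, hβα⟩ : ∃ β : ℝ, M < ∑ i : Fin n, β ^ (i : ℕ) ∧ 0 < β ∧ β < α := by
    have hcont : Continuous fun β : ℝ => ∑ i : Fin n, β ^ (i : ℕ) := by fun_prop
    have hev := (hcont.continuousAt.eventually (lt_mem_nhds hMα)).filter_mono
      (nhdsWithin_le_nhds (s := Set.Iio α))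
    exact (hev.and (Ioo_mem_nhdsLT hα0)).exists
  have hn : 0 < n := by
    rcases Nat.eq_zero_or_pos n with rfl | h
    · simp at hMβ
      linarith
    · exact h
  have hn' : (0 : ℝ) < n := by exact_mod_cast hn
  obtain ⟨c, hc, hcM⟩ : ∃ c : ℝ, 0 < c ∧ M * (1 + n * c) = ∑ i : Fin n, β ^ (i : ℕ) := by
    refine ⟨((∑ i : Fin n, β ^ (i : ℕ)) - M) / (n * M),
      div_pos (sub_pos.2 hMβ) (mul_pos hn' hM), ?_⟩
    field_simp
    ring
  have hpow : ∀ i : Fin n, 0 < β ^ (i : ℕ) := fun i => pow_pos hβ0 _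
  have hr : ∀ i : Fin n, 0 < β ^ (i : ℕ) / c := fun i => div_pos (hpow i) hc
  have hv : ∀ i : Fin n, 0 < c / β ^ (i : ℕ) := fun i => div_pos hc (hpow i)
  refine ⟨fun i => β ^ (i : ℕ) / c, fun i => c / β ^ (i : ℕ), hr, hv, ?_⟩
  have hdet : RstarDet n (fun i => β ^ (i : ℕ) / c) (fun i => c / β ^ (i : ℕ)) α ≤ 1 := by
    refine RstarDet_le_one hv (fun i => ?_)
      fun S => eq_of_detFeasible_geometric hβ0 hβα hα1 hc
    have := (hpow i).ne'
    field_simp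
  have hD : 0 < 1 + n * c := by positivity
  have hfeas : BMSFeasible n (fun i => c / β ^ (i : ℕ)) α (1 / (1 + n * c))
      (fun _ => c / (1 + n * c)) := by
    refine ⟨?_, fun i => ⟨by positivity, ?_⟩, fun i => Or.inr fun j => ?_⟩
    · simp only [Finset.sum_const, Finset.card_univ, Fintype.card_fin, nsmul_eq_mul]
      field_simp
    · rw [← mul_one_div c (1 + n * c)]
      refine mul_le_mul_of_nonneg_right ?_ (by positivity)
      rw [le_div_iff₀ (hpow i)]
      exact mul_le_of_le_one_right hc.le (pow_le_one₀ hβ0.le (hβα.le.trans hα1))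
    · exact mul_le_of_le_one_left (by positivity) hα1
  calc M * RstarDet n (fun i => β ^ (i : ℕ) / c) (fun i => c / β ^ (i : ℕ)) α
      ≤ M := mul_le_of_le_one_right hM.le hdet
    _ = ∑ i : Fin n, β ^ (i : ℕ) / c * (c / (1 + n * c)) := by
        rw [← Finset.sum_mul, ← Finset.sum_div, ← hcM]
        field_simp
    _ ≤ _ := le_Rstar hr hv hfeas

/-- for every `n ≥ 1` and `α ∈ (0,1]` there is an instance where
randomization gains a factor `min{1/(2(1-α)), n/2}`. -/
theorem stmt_2 (n : ℕ) (hn : 1 ≤ n) (α : ℝ) (hα0 : 0 < α) (hα1 : α ≤ 1) :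
    ∃ r v : Fin n → ℝ, (∀ i, 0 < r i) ∧ (∀ i, 0 < v i) ∧
      (((n : ℝ) / 2) * RstarDet n r v α ≤ Rstar n r v α ∨
        (α < 1 ∧ RstarDet n r v α ≤ 2 * (1 - α) * Rstar n r v α)) := by
  by_cases h : α ^ n < 1 / 2
  · have hα : α < 1 := by
      refine lt_of_le_of_ne hα1 ?_
      rintro rfl
      norm_num at h
    have hpos : 0 < 2 * (1 - α) := by linarith
    have hlt : 1 / (2 * (1 - α)) < ∑ i : Fin n, α ^ (i : ℕ) := by
      rw [Fin.sum_univ_eq_sum_range (fun i => α ^ i) n, div_lt_iff₀ hpos]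
      have := geom_sum_mul_neg α n
      linarith
    obtain ⟨r, v, hr, hv, hle⟩ := exists_instance_of_lt_geom_sum hα0 hα1 (by positivity) hlt
    refine ⟨r, v, hr, hv, Or.inr ⟨hα, ?_⟩⟩
    rwa [one_div, inv_mul_le_iff₀ hpos] at hle
  · have hn' : (0 : ℝ) < n := by exact_mod_cast hn
    have hlt : (n : ℝ) / 2 < ∑ i : Fin n, α ^ (i : ℕ) := by
      calc (n : ℝ) / 2 = ∑ _i : Fin n, (1 / 2 : ℝ) := by
            simp only [Finset.sum_const, Finset.card_univ, Fintype.card_fin, nsmul_eq_mul]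
            ring
        _ < _ := by
            refine Finset.sum_lt_sum (fun i _ => ?_) ⟨⟨0, hn⟩, Finset.mem_univ _, by norm_num⟩
            exact (not_lt.1 h).trans (pow_le_pow_of_le_one hα0.le hα1 i.isLt.le)
    obtain ⟨r, v, hr, hv, hle⟩ := exists_instance_of_lt_geom_sum hα0 hα1 (by positivity) hlt
    exact ⟨r, v, hr, hv, Or.inl hle⟩
end
end

section
/- Fix n ≥ 1, revenues r_i > 0 and MNL preference weights v_i > 0 for i ∈ {1,…,n}, and a balancing parameter α ∈ (0,1]. Then there exist v̄ ∈ {v_1,…,v_n} and a BMS-feasible vector x* attaining the optimal value R* (i.e., ∑_{i=1}^n r_i x*_i = R*) such that {i ∈ {1,…,n} : x*_i > 0} = {i ∈ {1,…,n} : r_i ≥ R* and v_i ≥ v̄}. -/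
open Classical Finset

noncomputable section

/-- Attraction weights satisfying the balancing constraint yield, after normalization, a
BMS-feasible vector. -/
theorem bmsFeasible_of_weights {n : ℕ} {v w : Fin n → ℝ} {α : ℝ}
    (hw : ∀ i, 0 ≤ w i ∧ w i ≤ v i) (hbal : ∀ i, w i = 0 ∨ ∀ j, α * w j ≤ w i) :
    BMSFeasible n v α (1 + ∑ i, w i)⁻¹ (fun i => w i * (1 + ∑ i, w i)⁻¹) := by
  have hs : 0 < 1 + ∑ i, w i := by
    have := Finset.sum_nonneg fun i (_ : i ∈ Finset.univ) => (hw i).1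
    linarith
  have hs' := inv_pos.2 hs
  refine ⟨?_, fun i => ⟨mul_nonneg (hw i).1 hs'.le,
    mul_le_mul_of_nonneg_right (hw i).2 hs'.le⟩, fun i => ?_⟩
  · rw [← Finset.sum_mul]
    field_simp
  · rcases hbal i with h | h
    · left
      simp [h]
    · right
      intro j
      rw [← mul_assoc]
      exact mul_le_mul_of_nonneg_right (h j) hs'.le

theorem BMSFeasible.pos {n : ℕ} {v x : Fin n → ℝ} {α x0 : ℝ} (hv : ∀ i, 0 < v i)
    (h : BMSFeasible n v α x0 x) : 0 < x0 := by
  by_contra! h0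
  have hx : ∑ i, x i ≤ 0 := Finset.sum_nonpos fun i _ =>
    (h.2.1 i).2.trans (mul_nonpos_of_nonneg_of_nonpos (hv i).le h0)
  linarith [h.1]

theorem isCompact_setOf_bmsFeasible {n : ℕ} {v : Fin n → ℝ} (hv : ∀ i, 0 < v i) (α : ℝ) :
    IsCompact {p : ℝ × (Fin n → ℝ) | BMSFeasible n v α p.1 p.2} := by
  refine IsCompact.of_isClosed_subset
    (isCompact_Icc (a := ((0, 0) : ℝ × (Fin n → ℝ))) (b := (1, 1))) ?_ ?_
  · simp only [BMSFeasible, Set.ofPred_and, Set.ofPred_forall, Set.ofPred_or]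
    refine (isClosed_eq (by fun_prop) (by fun_prop)).inter (IsClosed.inter ?_ ?_)
    · exact isClosed_iInter fun i => (isClosed_le (by fun_prop) (by fun_prop)).inter
        (isClosed_le (by fun_prop) (by fun_prop))
    · exact isClosed_iInter fun i => (isClosed_eq (by fun_prop) (by fun_prop)).union
        (isClosed_iInter fun j => isClosed_le (by fun_prop) (by fun_prop))
  · rintro ⟨x0, x⟩ h
    have h0 : 0 < x0 := BMSFeasible.pos hv h
    obtain ⟨h1, h2, -⟩ := h
    dsimp only at h1 h2
    have hs := Finset.sum_nonneg fun i (_ : i ∈ Finset.univ) => (h2 i).1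
    refine ⟨⟨h0.le, fun i => (h2 i).1⟩, ⟨by dsimp only; linarith, fun i => ?_⟩⟩
    have := Finset.single_le_sum (fun i _ => (h2 i).1) (Finset.mem_univ i)
    simp only [Pi.one_apply]
    linarith

theorem isGreatest_Rstar {n : ℕ} {v : Fin n → ℝ} (hv : ∀ i, 0 < v i)
    (r : Fin n → ℝ) (α : ℝ) :
    IsGreatest {R | ∃ x0 x, BMSFeasible n v α x0 x ∧ ∑ i, r i * x i = R} (Rstar n r v α) := by
  have hne : {p : ℝ × (Fin n → ℝ) | BMSFeasible n v α p.1 p.2}.Nonempty :=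
    ⟨(_, _), bmsFeasible_of_weights (w := 0) (fun i => ⟨le_rfl, (hv i).le⟩) fun i => Or.inl rfl⟩
  obtain ⟨p, hp, hmax⟩ := (isCompact_setOf_bmsFeasible hv α).exists_isMaxOn hne
    (f := fun p => ∑ i, r i * p.2 i) (by fun_prop)
  have hg : IsGreatest {R | ∃ x0 x, BMSFeasible n v α x0 x ∧ ∑ i, r i * x i = R}
      (∑ i, r i * p.2 i) := by
    refine ⟨⟨p.1, p.2, hp, rfl⟩, ?_⟩
    rintro _ ⟨x0, x, hx, rfl⟩
    exact hmax (show (x0, x) ∈ {p : ℝ × (Fin n → ℝ) | BMSFeasible n v α p.1 p.2} from hx)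
  rw [Rstar, hg.csSup_eq]
  exact hg

theorem Rstar_pos {n : ℕ} {r v : Fin n → ℝ} (hr : ∀ i, 0 < r i) (hv : ∀ i, 0 < v i)
    {α : ℝ} (hα1 : α ≤ 1) (k : Fin n) : 0 < Rstar n r v α := by
  have hw : ∀ i, 0 ≤ (Pi.single k (v k) : Fin n → ℝ) i ∧
      (Pi.single k (v k) : Fin n → ℝ) i ≤ v i := by
    intro i
    rcases eq_or_ne i k with rfl | h
    · simp [(hv i).le]
    · simp [h, (hv i).le]
  have hf := bmsFeasible_of_weights (α := α) hw (by
    intro i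
    rcases eq_or_ne i k with rfl | h
    · right
      intro j
      rcases eq_or_ne j i with rfl | h
      · simpa using mul_le_of_le_one_left (hv j).le hα1
      · simp [h, (hv i).le]
    · left
      simp [h])
  refine lt_of_lt_of_le ?_ ((isGreatest_Rstar hv r α).2 ⟨_, _, hf, rfl⟩)
  have h0 := hf.pos hv
  refine Finset.sum_pos' (fun i _ => mul_nonneg (hr i).le (mul_nonneg (hw i).1 h0.le))
    ⟨k, Finset.mem_univ k, mul_pos (hr k) (mul_pos ?_ h0)⟩
  simpa using hv k

/-- there is an optimal BMS-feasible solution whose support is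
exactly the set of products whose revenue is at least `R*` and whose
preference weight is at least some threshold `v̄ ∈ {v_1,…,v_n}`. -/
theorem stmt_3 (n : ℕ) (hn : 1 ≤ n) (r v : Fin n → ℝ)
    (hr : ∀ i, 0 < r i) (hv : ∀ i, 0 < v i)
    (α : ℝ) (hα0 : 0 < α) (hα1 : α ≤ 1) :
    ∃ vbar ∈ Set.range v, ∃ x0 : ℝ, ∃ x : Fin n → ℝ,
      BMSFeasible n v α x0 x ∧
      ∑ i, r i * x i = Rstar n r v α ∧
      {i : Fin n | 0 < x i} = {i : Fin n | Rstar n r v α ≤ r i ∧ vbar ≤ v i} := by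
  have k : Fin n := ⟨0, hn⟩
  have : Nonempty (Fin n) := ⟨k⟩
  have hR := Rstar_pos hr hv hα1 k
  obtain ⟨⟨x0, x, hx, hxR⟩, hub⟩ := isGreatest_Rstar hv r α
  set R := Rstar n r v α
  have hx0 := hx.pos hv
  obtain ⟨hsum, hbd, hbal⟩ := hx
  obtain ⟨m, hm⟩ := Finite.exists_max x
  have hxm : 0 < x m := by
    by_contra! h
    have : ∑ i, r i * x i ≤ 0 := Finset.sum_nonpos fun i _ =>
      mul_nonpos_of_nonneg_of_nonpos (hr i).le ((hm i).trans h)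
    linarith
  set M := x m / x0 with hM
  have hMpos : 0 < M := div_pos hxm hx0
  have hMv : M ≤ v m := (div_le_iff₀ hx0).2 (hbd m).2
  have hαM : α * M ≤ M := mul_le_of_le_one_left hMpos.le hα1
  -- Cap each weight at `M`, keeping exactly the profitable products that can be balanced.
  set w : Fin n → ℝ := fun i => if R ≤ r i ∧ α * M ≤ v i then min (v i) M else 0 with hw
  have hwM : ∀ i, w i ≤ M := fun i => by
    simp only [hw]
    split_ifs
    exacts [min_le_right _ _, hMpos.le]
  have hwv : ∀ i, 0 ≤ w i ∧ w i ≤ v i := fun i => by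
    simp only [hw]
    split_ifs
    exacts [⟨le_min (hv i).le hMpos.le, min_le_left _ _⟩, ⟨le_rfl, (hv i).le⟩]
  have hwbal : ∀ i, w i = 0 ∨ ∀ j, α * w j ≤ w i := fun i => by
    by_cases h : R ≤ r i ∧ α * M ≤ v i
    · right
      intro j
      refine (mul_le_mul_of_nonneg_left (hwM j) hα0.le).trans ?_
      simp only [hw, if_pos h]
      exact le_min h.2 hαM
    · left
      simp only [hw, if_neg h]
  have hwpos : ∀ i, 0 < w i ↔ R ≤ r i ∧ α * M ≤ v i := fun i => by
    by_cases h : R ≤ r i ∧ α * M ≤ v i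
    · simp [hw, h, hv i, hMpos]
    · simp only [hw, if_neg h, lt_irrefl, h]
  have hfeas := bmsFeasible_of_weights hwv hwbal
  have hpos := hfeas.pos hv
  have hterm : ∀ i, (r i - R) * (x i / x0) ≤ (r i - R) * w i := fun i => by
    have hnn : 0 ≤ x i / x0 := div_nonneg (hbd i).1 hx0.le
    have hle : x i / x0 ≤ v i := (div_le_iff₀ hx0).2 (hbd i).2
    have hleM : x i / x0 ≤ M := div_le_div_of_nonneg_right (hm i) hx0.le
    by_cases h1 : R ≤ r i
    · refine mul_le_mul_of_nonneg_left ?_ (sub_nonneg.2 h1)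
      by_cases h2 : α * M ≤ v i
      · simp only [hw, if_pos (And.intro h1 h2)]
        exact le_min hle hleM
      · rcases hbal i with h | h
        · simpa [h] using (hwv i).1
        · refine absurd (le_trans ?_ hle) h2
          rw [hM, ← mul_div_assoc]
          exact div_le_div_of_nonneg_right (h m) hx0.le
    · simp only [hw, h1, false_and, if_false, mul_zero]
      exact mul_nonpos_of_nonpos_of_nonneg (by linarith) hnn
  have hold : ∑ i, (r i - R) * (x i / x0) = R := by
    simp only [← mul_div_assoc]
    rw [← Finset.sum_div, div_eq_iff hx0.ne']
    simp only [sub_mul, Finset.sum_sub_distrib, ← Finset.mul_sum, hxR]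
    linear_combination (-R) * hsum
  have hnew : R * (1 + ∑ i, w i) ≤ ∑ i, r i * w i := by
    have h := Finset.sum_le_sum fun i (_ : i ∈ Finset.univ) => hterm i
    rw [hold] at h
    simp only [sub_mul, Finset.sum_sub_distrib, ← Finset.mul_sum] at h
    linarith
  obtain ⟨l, hl, hmin⟩ := Finset.exists_min_image
    (Finset.univ.filter fun i => α * M ≤ v i) v ⟨m, by simpa using hαM.trans hMv⟩
  simp only [Finset.mem_filter, Finset.mem_univ, true_and] at hl hmin
  refine ⟨v l, ⟨l, rfl⟩, _, _, hfeas, le_antisymm (hub ⟨_, _, hfeas, rfl⟩) ?_, ?_⟩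
  · simp only [← mul_assoc]
    rw [← Finset.sum_mul, ← div_eq_mul_inv, le_div_iff₀ (inv_pos.1 hpos)]
    exact hnew
  · ext i
    simp only [Set.mem_ofPred_eq, mul_pos_iff_of_pos_right hpos, hwpos]
    exact and_congr_right fun _ => ⟨hmin i, hl.trans⟩
end
end

section
/- Fix n ≥ 1, revenues r_i > 0 and MNL preference weights v_i > 0 for i ∈ {1,…,n}, and a balancing parameter α ∈ (0,1]. Then there exists v̄ ∈ {v_1,…,v_n} such that, defining w*_i = min{v_i, v̄/α} if r_i ≥ R* and v_i ≥ v̄, and w*_i = 0 otherwise, the vector x* with x*_i = w*_i/(1 + ∑_{j=1}^n w*_j) for i ∈ {1,…,n} and x*_0 = 1/(1 + ∑_{j=1}^n w*_j) is BMS-feasible and satisfies ∑_{i=1}^n r_i x*_i = R*. -/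
open Classical Finset

noncomputable section

/-- The closed-form candidate `w*` of Corollary 1:
`w*_i = min{v_i, v̄/α}` if `r_i ≥ R` and `v_i ≥ v̄`, and `w*_i = 0` otherwise. -/
def wStar (n : ℕ) (r v : Fin n → ℝ) (α R vbar : ℝ) : Fin n → ℝ :=
  fun i => if R ≤ r i ∧ vbar ≤ v i then min (v i) (vbar / α) else 0

section Feasible

variable {n : ℕ} {r v : Fin n → ℝ} {α x0 : ℝ} {x : Fin n → ℝ}

theorem BMSFeasible.one_le_mul (h : BMSFeasible n v α x0 x) : 1 ≤ x0 * (1 + ∑ i, v i) := by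
  have h1 : ∑ i, x i ≤ ∑ i, v i * x0 := sum_le_sum fun i _ => (h.2.1 i).2
  rw [← sum_mul] at h1
  linarith [h.1]

theorem BMSFeasible.x0_pos (hv : ∀ i, 0 < v i) (h : BMSFeasible n v α x0 x) : 0 < x0 := by
  have hV : 0 ≤ ∑ i, v i := sum_nonneg fun i _ => (hv i).le
  exact pos_of_mul_pos_left (one_pos.trans_le h.one_le_mul) (by linarith)

theorem BMSFeasible.le_one (hv : ∀ i, 0 < v i) (h : BMSFeasible n v α x0 x) (i : Fin n) :
    x i ≤ 1 := by
  have h1 : x i ≤ ∑ j, x j := single_le_sum (fun j _ => (h.2.1 j).1) (mem_univ i)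
  linarith [h.1, h.x0_pos hv]

theorem bddAbove_revenue (hr : ∀ i, 0 < r i) (hv : ∀ i, 0 < v i) :
    BddAbove {R | ∃ x0 x, BMSFeasible n v α x0 x ∧ ∑ i, r i * x i = R} := by
  refine ⟨∑ i, r i, ?_⟩
  rintro _ ⟨x0, x, h, rfl⟩
  exact sum_le_sum fun i _ => mul_le_of_le_one_right (hr i).le (h.le_one hv i)

theorem nonempty_revenue (hv : ∀ i, 0 < v i) :
    {R | ∃ x0 x, BMSFeasible n v α x0 x ∧ ∑ i, r i * x i = R}.Nonempty :=
  ⟨_, 1, fun _ => 0, ⟨by simp, fun i => ⟨le_rfl, by simpa using (hv i).le⟩,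
    fun _ => Or.inl rfl⟩, rfl⟩

theorem wStar_nonneg (hv : ∀ i, 0 < v i) (hα0 : 0 < α) {R vbar : ℝ} (hb : 0 < vbar)
    (i : Fin n) : 0 ≤ wStar n r v α R vbar i := by
  unfold wStar
  split_ifs
  · exact le_min (hv i).le (by positivity)
  · exact le_rfl

theorem wStar_le (hv : ∀ i, 0 < v i) {R vbar : ℝ} (i : Fin n) :
    wStar n r v α R vbar i ≤ v i := by
  unfold wStar
  split_ifs
  · exact min_le_left _ _
  · exact (hv i).le

theorem mul_wStar_le (hα0 : 0 < α) {R vbar : ℝ} (hb : 0 < vbar) (i : Fin n) :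
    α * wStar n r v α R vbar i ≤ vbar := by
  unfold wStar
  split_ifs
  · calc α * min (v i) (vbar / α) ≤ α * (vbar / α) := by gcongr; exact min_le_right _ _
      _ = vbar := by field_simp
  · simpa using hb.le

theorem wStar_eq_zero_or_le (hα0 : 0 < α) (hα1 : α ≤ 1) {R vbar : ℝ} (hb : 0 < vbar)
    (i : Fin n) : wStar n r v α R vbar i = 0 ∨ vbar ≤ wStar n r v α R vbar i := by
  unfold wStar
  split_ifs with h
  · exact Or.inr (le_min h.2 (le_div_self hb.le hα0 hα1))
  · exact Or.inl rfl

theorem wStar_feasible (hv : ∀ i, 0 < v i) (hα0 : 0 < α) (hα1 : α ≤ 1) {R vbar : ℝ}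
    (hb : 0 < vbar) :
    BMSFeasible n v α (1 / (1 + ∑ j, wStar n r v α R vbar j))
      (fun i => wStar n r v α R vbar i / (1 + ∑ j, wStar n r v α R vbar j)) := by
  have hS : 0 ≤ ∑ j, wStar n r v α R vbar j :=
    sum_nonneg fun i _ => wStar_nonneg hv hα0 hb i
  have hD : 0 < 1 + ∑ j, wStar n r v α R vbar j := by linarith
  refine ⟨?_, fun i => ⟨div_nonneg (wStar_nonneg hv hα0 hb i) hD.le, ?_⟩, fun i => ?_⟩
  · rw [← sum_div, ← add_div, div_self hD.ne']
  · rw [mul_one_div]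
    exact div_le_div_of_nonneg_right (wStar_le hv i) hD.le
  · rcases wStar_eq_zero_or_le (r := r) (v := v) (R := R) hα0 hα1 hb i with h | h
    · left
      simp only [h, zero_div]
    · right
      intro j
      rw [← mul_div_assoc]
      exact div_le_div_of_nonneg_right ((mul_wStar_le hα0 hb j).trans h) hD.le

/-- Every feasible point is dominated, in Lagrangian value at price `R`, by the closed form whose
threshold is the smallest weight in its support. -/
theorem BMSFeasible.exists_wStar_dominates (hn : 1 ≤ n) (hv : ∀ i, 0 < v i) (hα0 : 0 < α)
    (h : BMSFeasible n v α x0 x) (R : ℝ) :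
    ∃ k, ∑ i, (r i - R) * x i ≤ x0 * ∑ i, (r i - R) * wStar n r v α R (v k) i := by
  have hx0 := h.x0_pos hv
  obtain ⟨k, hk, hmin⟩ : ∃ k, (∀ j, α * x j ≤ v k * x0) ∧ ∀ i, x i ≠ 0 → v k ≤ v i := by
    rcases (univ.filter fun i => x i ≠ 0).eq_empty_or_nonempty with he | hne
    · have hz : ∀ i, x i = 0 := by simpa [filter_eq_empty_iff] using he
      refine ⟨⟨0, hn⟩, fun j => ?_, fun i hi => absurd (hz i) hi⟩
      rw [hz j, mul_zero]
      exact (mul_pos (hv _) hx0).le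
    · obtain ⟨k, hk, hmin⟩ := exists_min_image _ v hne
      have hk' : x k ≠ 0 := by simpa using hk
      exact ⟨k, fun j => ((h.2.2 k).resolve_left hk' j).trans (h.2.1 k).2,
        fun i hi => hmin i (by simpa using hi)⟩
  refine ⟨k, ?_⟩
  rw [mul_sum]
  refine sum_le_sum fun i _ => ?_
  rw [mul_left_comm]
  by_cases hR : R ≤ r i
  · refine mul_le_mul_of_nonneg_left ?_ (sub_nonneg.2 hR)
    by_cases hi : x i = 0
    · rw [hi]
      exact mul_nonneg hx0.le (wStar_nonneg hv hα0 (hv k) i)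
    · rw [wStar, if_pos ⟨hR, hmin i hi⟩, mul_comm x0, min_mul_of_nonneg _ _ hx0.le]
      refine le_min (h.2.1 i).2 ?_
      rw [div_mul_eq_mul_div, le_div_iff₀ hα0, mul_comm]
      exact hk i
  · rw [wStar, if_neg fun h => hR h.1, mul_zero, mul_zero]
    exact mul_nonpos_of_nonpos_of_nonneg (by linarith) (h.2.1 i).1

end Feasible

/-- there is a threshold `v̄ ∈ {v_1,…,v_n}` such that the
closed-form solution reconstructed from `w*` is BMS-feasible and optimal. -/
theorem stmt_5 (n : ℕ) (hn : 1 ≤ n) (r v : Fin n → ℝ)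
    (hr : ∀ i, 0 < r i) (hv : ∀ i, 0 < v i)
    (α : ℝ) (hα0 : 0 < α) (hα1 : α ≤ 1) :
    ∃ vbar ∈ Set.range v,
      BMSFeasible n v α
        (1 / (1 + ∑ j, wStar n r v α (Rstar n r v α) vbar j))
        (fun i => wStar n r v α (Rstar n r v α) vbar i /
          (1 + ∑ j, wStar n r v α (Rstar n r v α) vbar j)) ∧
      ∑ i, r i * (wStar n r v α (Rstar n r v α) vbar i /
          (1 + ∑ j, wStar n r v α (Rstar n r v α) vbar j)) = Rstar n r v α := by
  set R := Rstar n r v α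
  have : Nonempty (Fin n) := ⟨⟨0, hn⟩⟩
  obtain ⟨k, hk⟩ := Finite.exists_max fun k => ∑ i, (r i - R) * wStar n r v α R (v k) i
  have hfeas := wStar_feasible (r := r) (R := R) hv hα0 hα1 (hv k)
  refine ⟨v k, ⟨k, rfl⟩, hfeas, ?_⟩
  set D := 1 + ∑ j, wStar n r v α R (v k) j with hD
  have hDpos : 0 < D := by
    have := hfeas.x0_pos hv
    simpa using this
  refine le_antisymm (le_csSup (bddAbove_revenue hr hv) ⟨_, _, hfeas, rfl⟩) ?_
  have hval : ∑ i, r i * (wStar n r v α R (v k) i / D)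
      = (∑ i, r i * wStar n r v α R (v k) i) / D := by
    simp_rw [← mul_div_assoc, sum_div]
  have hlag : ∑ i, (r i - R) * wStar n r v α R (v k) i
      = ∑ i, r i * wStar n r v α R (v k) i - R * (D - 1) := by
    simp_rw [sub_mul, sum_sub_distrib, ← mul_sum, hD, add_sub_cancel_left]
  rw [hval, le_div_iff₀ hDpos]
  by_contra! hlt
  set M := ∑ i, (r i - R) * wStar n r v α R (v k) i
  have hM : M < R := by linarith
  have hV : 0 < 1 + ∑ i, v i := by
    have := sum_nonneg fun i (_ : i ∈ univ) => (hv i).le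
    linarith
  have hle : R ≤ R - (R - M) / (1 + ∑ i, v i) := by
    refine csSup_le (nonempty_revenue hv) ?_
    rintro _ ⟨x0, x, h, rfl⟩
    obtain ⟨l, hl⟩ := h.exists_wStar_dominates (r := r) hn hv hα0 R
    have hbound := hl.trans (mul_le_mul_of_nonneg_left (hk l) (h.x0_pos hv).le)
    have hx0 : (R - M) / (1 + ∑ i, v i) ≤ (R - M) * x0 := by
      rw [div_le_iff₀ hV, mul_assoc]
      exact le_mul_of_one_le_right (by linarith) h.one_le_mul
    have hsum : ∑ i, (r i - R) * x i = ∑ i, r i * x i - R * (1 - x0) := by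
      simp_rw [sub_mul, sum_sub_distrib, ← mul_sum, ← h.1, add_sub_cancel_left]
    rw [hsum] at hbound
    change _ ≤ x0 * M at hbound
    linarith
  have : 0 < (R - M) / (1 + ∑ i, v i) := div_pos (by linarith) hV
  linarith
end
end

section
/- Fix n ≥ 1, revenues r_i > 0 and MNL preference weights v_i > 0 for i ∈ {1,…,n}, a balancing parameter α ∈ (0,1], and a nonempty collection 𝒳 of subsets of {1,…,n}. Then (a) the supremum of ∑_{i=1}^n (r_i − R*_𝒳)·w_i over all Problem-(6)-feasible vectors w ∈ ℝ^n equals R*_𝒳; and (b) if w* is Problem-(6)-feasible and attains this supremum, then the vector x* defined by x*_i = w*_i/(1 + ∑_{j=1}^n w*_j) for i ∈ {1,…,n} and x*_0 = 1/(1 + ∑_{j=1}^n w*_j) is BMS-C-feasible and satisfies ∑_{i=1}^n r_i x*_i = R*_𝒳. -/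
open Classical Finset

noncomputable section

/-- The support of a purchase-probability vector, as a finite set of products. -/
def suppF (n : ℕ) (x : Fin n → ℝ) : Finset (Fin n) :=
  Finset.univ.filter (fun i => 0 < x i)

/-- A vector `(x0, x)` is BMS-C-feasible: it is BMS-feasible and the set of
products offered with positive probability belongs to `𝒳`. -/
def BMSCFeasible (n : ℕ) (v : Fin n → ℝ) (α : ℝ) (𝒳 : Set (Finset (Fin n)))
    (x0 : ℝ) (x : Fin n → ℝ) : Prop :=
  BMSFeasible n v α x0 x ∧ suppF n x ∈ 𝒳

/-- Optimal value `R*_𝒳` of the constrained problem BMS-C. -/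
def RstarX (n : ℕ) (r v : Fin n → ℝ) (α : ℝ) (𝒳 : Set (Finset (Fin n))) : ℝ :=
  sSup {R | ∃ x0 x, BMSCFeasible n v α 𝒳 x0 x ∧ ∑ i, r i * x i = R}

/-- A vector `w` is Problem-(6)-feasible: `0 ≤ w i ≤ v i`, each coordinate is
either zero or at least `α` times the maximum coordinate, and the support of
`w` belongs to `𝒳`. -/
def P6Feasible (n : ℕ) (v : Fin n → ℝ) (α : ℝ) (𝒳 : Set (Finset (Fin n)))
    (w : Fin n → ℝ) : Prop :=
  (∀ i, 0 ≤ w i ∧ w i ≤ v i) ∧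
  (∀ i, w i = 0 ∨ ∀ j, α * w j ≤ w i) ∧
  suppF n w ∈ 𝒳

section

variable {n : ℕ} {r v : Fin n → ℝ} {α : ℝ} {𝒳 : Set (Finset (Fin n))}

/-- Dividing by a positive constant does not change the support. -/
lemma suppF_div (w : Fin n → ℝ) {c : ℝ} (hc : 0 < c) :
    suppF n (fun i => w i / c) = suppF n w := by
  ext i
  simp [suppF, div_pos_iff_of_pos_right hc]

/-- The balancing condition is invariant under division by a positive constant. -/
lemma balanced_div {w : Fin n → ℝ} {c : ℝ} (hc : 0 < c)
    (hw : ∀ i, w i = 0 ∨ ∀ j, α * w j ≤ w i) (i : Fin n) :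
    w i / c = 0 ∨ ∀ j, α * (w j / c) ≤ w i / c := by
  refine (hw i).imp (fun h => by simp [h]) fun h j => ?_
  rw [← mul_div_assoc]
  exact div_le_div_of_nonneg_right (h j) hc.le

lemma P6Feasible.one_add_sum_pos {w : Fin n → ℝ} (hw : P6Feasible n v α 𝒳 w) :
    0 < 1 + ∑ j, w j := by
  have : 0 ≤ ∑ j, w j := sum_nonneg fun j _ => (hw.1 j).1
  linarith

/-- Normalizing a Problem-(6)-feasible vector gives a BMS-C-feasible vector. -/
lemma P6Feasible.bmscFeasible {w : Fin n → ℝ} (hw : P6Feasible n v α 𝒳 w) :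
    BMSCFeasible n v α 𝒳 (1 / (1 + ∑ j, w j)) (fun i => w i / (1 + ∑ j, w j)) := by
  have hpos := hw.one_add_sum_pos
  refine ⟨⟨?_, fun i => ⟨div_nonneg (hw.1 i).1 hpos.le, ?_⟩, balanced_div hpos hw.2.1⟩, ?_⟩
  · rw [← sum_div, ← add_div, div_self hpos.ne']
  · rw [mul_one_div]
    exact div_le_div_of_nonneg_right (hw.1 i).2 hpos.le
  · rw [suppF_div w hpos]
    exact hw.2.2

lemma BMSCFeasible.zero_lt (hv : ∀ i, 0 < v i) {x0 : ℝ} {x : Fin n → ℝ}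
    (hx : BMSCFeasible n v α 𝒳 x0 x) : 0 < x0 := by
  have h1 := hx.1.1
  have h2 : ∑ i, x i ≤ (∑ i, v i) * x0 := by
    rw [sum_mul]
    exact sum_le_sum fun i _ => (hx.1.2.1 i).2
  have h3 : 0 ≤ ∑ i, v i := sum_nonneg fun i _ => (hv i).le
  by_contra! h
  nlinarith

/-- Dividing a BMS-C-feasible vector by its no-purchase probability gives a
Problem-(6)-feasible vector. -/
lemma BMSCFeasible.p6Feasible (hv : ∀ i, 0 < v i) {x0 : ℝ} {x : Fin n → ℝ}
    (hx : BMSCFeasible n v α 𝒳 x0 x) : P6Feasible n v α 𝒳 (fun i => x i / x0) := by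
  have h0 := hx.zero_lt hv
  refine ⟨fun i => ⟨div_nonneg (hx.1.2.1 i).1 h0.le, ?_⟩, balanced_div h0 hx.1.2.2, ?_⟩
  · exact (div_le_iff₀ h0).2 (hx.1.2.1 i).2
  · rw [suppF_div x h0]
    exact hx.2

lemma exists_p6Feasible (hv : ∀ i, 0 < v i) (hα1 : α ≤ 1) (hX : 𝒳.Nonempty) :
    ∃ w, P6Feasible n v α 𝒳 w := by
  obtain ⟨S, hS⟩ := hX
  obtain ⟨m, hm, hmv⟩ : ∃ m : ℝ, 0 < m ∧ ∀ i, m ≤ v i := by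
    obtain hn | hn := isEmpty_or_nonempty (Fin n)
    · exact ⟨1, one_pos, fun i => hn.elim i⟩
    · obtain ⟨i, hi⟩ := Finite.exists_min v
      exact ⟨v i, hv i, hi⟩
  refine ⟨fun i => if i ∈ S then m else 0, fun i => ?_, fun i => ?_, ?_⟩
  · dsimp only
    split_ifs
    exacts [⟨hm.le, hmv i⟩, ⟨le_rfl, (hv i).le⟩]
  · by_cases hi : i ∈ S
    · refine Or.inr fun j => ?_
      simp only [hi, if_true]
      split_ifs
      · nlinarith
      · simpa using hm.le
    · exact Or.inl (if_neg hi)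
  · convert hS
    ext i
    by_cases hi : i ∈ S <;> simp [suppF, hi, hm]

lemma bddAbove_bmsc_revenue (hr : ∀ i, 0 < r i) (hv : ∀ i, 0 < v i) :
    BddAbove {R | ∃ x0 x, BMSCFeasible n v α 𝒳 x0 x ∧ ∑ i, r i * x i = R} := by
  refine ⟨∑ i, r i, ?_⟩
  rintro _ ⟨x0, x, hx, rfl⟩
  refine sum_le_sum fun i _ => mul_le_of_le_one_right (hr i).le ?_
  have h0 := hx.zero_lt hv
  have h1 := hx.1.1
  have h2 := single_le_sum (fun j _ => (hx.1.2.1 j).1) (mem_univ i)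
  linarith

lemma sum_sub_const_mul (r w : Fin n → ℝ) (R : ℝ) :
    ∑ i, (r i - R) * w i = ∑ i, r i * w i - R * ∑ i, w i := by
  simp only [sub_mul, sum_sub_distrib, mul_sum]

lemma sum_mul_div (r w : Fin n → ℝ) (c : ℝ) :
    ∑ i, r i * (w i / c) = (∑ i, r i * w i) / c := by
  simp only [← mul_div_assoc, sum_div]

/-- `R*_𝒳` is the least upper bound of the objective of Problem (6). -/
lemma isLUB_p6 (hr : ∀ i, 0 < r i) (hv : ∀ i, 0 < v i) (hα1 : α ≤ 1) (hX : 𝒳.Nonempty) :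
    IsLUB {val : ℝ | ∃ w : Fin n → ℝ, P6Feasible n v α 𝒳 w ∧
      ∑ i, (r i - RstarX n r v α 𝒳) * w i = val} (RstarX n r v α 𝒳) := by
  obtain ⟨w₀, hw₀⟩ := exists_p6Feasible hv hα1 hX
  have hlub : IsLUB {R | ∃ x0 x, BMSCFeasible n v α 𝒳 x0 x ∧ ∑ i, r i * x i = R}
      (RstarX n r v α 𝒳) :=
    isLUB_csSup ⟨_, _, _, hw₀.bmscFeasible, rfl⟩ (bddAbove_bmsc_revenue hr hv)
  set R := RstarX n r v α 𝒳
  constructor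
  · rintro _ ⟨w, hw, rfl⟩
    have h := hlub.1 ⟨_, _, hw.bmscFeasible, rfl⟩
    rw [sum_mul_div, div_le_iff₀ hw.one_add_sum_pos] at h
    rw [sum_sub_const_mul]
    linarith
  · intro b hb
    have hV : 0 ≤ ∑ i, v i := sum_nonneg fun i _ => (hv i).le
    by_contra! hlt
    have hε : 0 < (R - b) / (1 + ∑ i, v i) := div_pos (by linarith) (by linarith)
    obtain ⟨_, ⟨x0, x, hx, rfl⟩, hgt, -⟩ := hlub.exists_between (sub_lt_self R hε)
    have h0 := hx.zero_lt hv
    have h1 := hx.1.1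
    have hw := hb ⟨_, hx.p6Feasible hv, rfl⟩
    have h2 : ∑ i, x i ≤ (∑ i, v i) * x0 := by
      rw [sum_mul]
      exact sum_le_sum fun i _ => (hx.1.2.1 i).2
    rw [sum_mul_div, sum_sub_const_mul, div_le_iff₀ h0, eq_sub_of_add_eq' h1] at hw
    have h3 : (R - b) / (1 + ∑ i, v i) ≤ (R - b) * x0 := by
      rw [div_le_iff₀ (by linarith)]
      nlinarith
    linarith

end

/-- (a) the optimal value of Problem (6) is `R*_𝒳`; and (b) from
any optimal solution `w*` of Problem (6), the reconstruction
`x*_i = w*_i / (1 + ∑_j w*_j)`, `x*_0 = 1/(1 + ∑_j w*_j)` is an optimal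
BMS-C-feasible solution. -/
theorem stmt_6 (n : ℕ) (hn : 1 ≤ n) (r v : Fin n → ℝ)
    (hr : ∀ i, 0 < r i) (hv : ∀ i, 0 < v i)
    (α : ℝ) (hα0 : 0 < α) (hα1 : α ≤ 1)
    (𝒳 : Set (Finset (Fin n))) (hX : 𝒳.Nonempty) :
    sSup {val : ℝ | ∃ w : Fin n → ℝ, P6Feasible n v α 𝒳 w ∧
        ∑ i, (r i - RstarX n r v α 𝒳) * w i = val} = RstarX n r v α 𝒳 ∧
    ∀ w : Fin n → ℝ, P6Feasible n v α 𝒳 w →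
      ∑ i, (r i - RstarX n r v α 𝒳) * w i =
        sSup {val : ℝ | ∃ w' : Fin n → ℝ, P6Feasible n v α 𝒳 w' ∧
          ∑ i, (r i - RstarX n r v α 𝒳) * w' i = val} →
      BMSCFeasible n v α 𝒳 (1 / (1 + ∑ j, w j)) (fun i => w i / (1 + ∑ j, w j)) ∧
      ∑ i, r i * (w i / (1 + ∑ j, w j)) = RstarX n r v α 𝒳 := by
  have hlub := isLUB_p6 (α := α) hr hv hα1 hX
  obtain ⟨w₀, hw₀⟩ := exists_p6Feasible hv hα1 hX
  have hsup := hlub.csSup_eq ⟨_, w₀, hw₀, rfl⟩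
  refine ⟨hsup, fun w hw heq => ⟨hw.bmscFeasible, ?_⟩⟩
  rw [hsup, sum_sub_const_mul] at heq
  rw [sum_mul_div, div_eq_iff hw.one_add_sum_pos.ne']
  linarith
end
end

section
/- Fix n ≥ 1, revenues r_i > 0 and MNL preference weights v_i > 0 for i ∈ {1,…,n}, a balancing parameter α ∈ (0,1], and a nonempty collection 𝒳 of subsets of {1,…,n}. Suppose v̄ > 0 and S* ∈ 𝒳 satisfy the conditions of the structural lemma for Problem (6): v̄ ∈ {v_i : i} ∪ {α·v_i : i}, v_i ≥ v̄ for all i ∈ S*, and the vector w* defined by w*_i = min{v_i, v̄/α} if i ∈ S* and r_i ≥ R*_𝒳, w*_i = v̄ if i ∈ S* and r_i < R*_𝒳, w*_i = 0 if i ∉ S*, is Problem-(6)-feasible with ∑_{i=1}^n (r_i − R*_𝒳)·w*_i = R*_𝒳. Then the supremum of (∑_{i∈S} r_i v'_i)/(1 + ∑_{i∈S} v'_i) over all S ⊆ S⁺(v̄) with S ∈ 𝒳 equals R*_𝒳, and S* attains this supremum. -/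
open Classical Finset

noncomputable section

/-- The structural candidate solution of Lemma 3 (Equation (7)):
`w*_i = min{v_i, v̄/α}` if `i ∈ S*` and `r_i ≥ R`, `w*_i = v̄` if `i ∈ S*` and
`r_i < R`, and `w*_i = 0` if `i ∉ S*`. -/
def wStarC (n : ℕ) (r v : Fin n → ℝ) (α R vbar : ℝ) (S : Finset (Fin n)) :
    Fin n → ℝ :=
  fun i => if i ∈ S then (if R ≤ r i then min (v i) (vbar / α) else vbar) else 0

/-- The modified preference weights `v'` used in Transformed-MNL:
`v'_i = v̄` if `r_i < R` and `v'_i = min{v_i, v̄/α}` if `r_i ≥ R`. -/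
def modW (n : ℕ) (r v : Fin n → ℝ) (α R vbar : ℝ) : Fin n → ℝ :=
  fun i => if R ≤ r i then min (v i) (vbar / α) else vbar

/-- Every objective value of BMS-C is at most the corresponding `RstarX`. -/
theorem bmsc_value_le_RstarX (n : ℕ) (hn : 1 ≤ n) (r v : Fin n → ℝ)
    (hr : ∀ i, 0 < r i) (hv : ∀ i, 0 < v i) (α : ℝ) (𝒳 : Set (Finset (Fin n)))
    (x0 : ℝ) (x : Fin n → ℝ) (h : BMSCFeasible n v α 𝒳 x0 x) :
    ∑ i, r i * x i ≤ RstarX n r v α 𝒳 := by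
  refine le_csSup ⟨∑ i, r i, ?_⟩ ⟨x0, x, h, rfl⟩
  rintro _ ⟨y0, y, ⟨⟨hsum, hbd, -⟩, -⟩, rfl⟩
  have hy0 : 0 ≤ y0 :=
    nonneg_of_mul_nonneg_right ((hbd ⟨0, hn⟩).1.trans (hbd ⟨0, hn⟩).2) (hv _)
  refine Finset.sum_le_sum fun i _ => ?_
  have hyi : y i ≤ ∑ j, y j :=
    Finset.single_le_sum (f := y) (fun j _ => (hbd j).1) (Finset.mem_univ i)
  exact mul_le_of_le_one_right (hr i).le (by linarith)

theorem modW_mem_Icc {n : ℕ} (r v : Fin n → ℝ) {α : ℝ} (hα0 : 0 < α) (hα1 : α ≤ 1)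
    (R : ℝ) {vbar : ℝ} (hvbar : 0 < vbar) {i : Fin n} (hi : vbar ≤ v i) :
    vbar ≤ modW n r v α R vbar i ∧ modW n r v α R vbar i ≤ v i ∧
      α * modW n r v α R vbar i ≤ vbar := by
  have hle : vbar ≤ vbar / α := by
    rw [le_div_iff₀ hα0]
    nlinarith
  unfold modW
  split_ifs
  · refine ⟨le_min hi hle, min_le_left _ _, ?_⟩
    calc α * min (v i) (vbar / α) ≤ α * (vbar / α) := by
          gcongr
          exact min_le_right _ _
      _ = vbar := by field_simp
  · exact ⟨le_rfl, hi, by nlinarith⟩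

/-- The MNL choice probabilities of an admissible assortment under the modified weights
are BMS-C-feasible, so its expected revenue is at most `RstarX`. -/
theorem transformed_revenue_le_RstarX (n : ℕ) (hn : 1 ≤ n) (r v : Fin n → ℝ)
    (hr : ∀ i, 0 < r i) (hv : ∀ i, 0 < v i) (α : ℝ) (hα0 : 0 < α) (hα1 : α ≤ 1)
    (𝒳 : Set (Finset (Fin n))) (R vbar : ℝ) (hvbar : 0 < vbar)
    (S : Finset (Fin n)) (hS : ∀ i ∈ S, vbar ≤ v i) (hSX : S ∈ 𝒳) :
    (∑ i ∈ S, r i * modW n r v α R vbar i) / (1 + ∑ i ∈ S, modW n r v α R vbar i) ≤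
      RstarX n r v α 𝒳 := by
  set w := modW n r v α R vbar
  have hb : ∀ i ∈ S, vbar ≤ w i ∧ w i ≤ v i ∧ α * w i ≤ vbar := fun i hi =>
    modW_mem_Icc r v hα0 hα1 R hvbar (hS i hi)
  have hD : 0 < 1 + ∑ i ∈ S, w i := by
    have : 0 ≤ ∑ i ∈ S, w i := Finset.sum_nonneg fun i hi => hvbar.le.trans (hb i hi).1
    linarith
  set D := 1 + ∑ i ∈ S, w i with hDdef
  have hrev : (∑ i ∈ S, r i * w i) / D = ∑ i, r i * (if i ∈ S then w i / D else 0) := by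
    simp only [mul_ite, mul_zero, Finset.sum_ite_mem, Finset.univ_inter, Finset.sum_div,
      mul_div_assoc]
  rw [hrev]
  refine bmsc_value_le_RstarX n hn r v hr hv α 𝒳 (1 / D) _ ⟨⟨?_, fun i => ?_, fun i => ?_⟩, ?_⟩
  · rw [Finset.sum_ite_mem, Finset.univ_inter, ← Finset.sum_div, ← add_div, ← hDdef,
      div_self hD.ne']
  · by_cases hi : i ∈ S
    · have := hb i hi
      simp only [hi, if_true]
      refine ⟨div_nonneg (by linarith) hD.le, ?_⟩
      rw [mul_one_div]
      gcongr
      exact this.2.1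
    · simp only [hi, if_false]
      exact ⟨le_rfl, mul_nonneg (hv i).le (one_div_pos.2 hD).le⟩
  · by_cases hi : i ∈ S
    · right
      intro j
      have hwi := hb i hi
      simp only [hi, if_true]
      by_cases hj : j ∈ S
      · simp only [hj, if_true]
        rw [← mul_div_assoc]
        gcongr
        exact (hb j hj).2.2.trans hwi.1
      · simp only [hj, if_false, mul_zero]
        exact div_nonneg (by linarith) hD.le
    · left
      simp [hi]
  · convert hSX using 1
    ext i
    by_cases hi : i ∈ S
    · simp [suppF, hi, div_pos (hvbar.trans_le (hb i hi).1) hD]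
    · simp [suppF, hi]

/-- Lemma 4: if `v̄` and `S*` satisfy the conditions of the
structural lemma for Problem (6), then the optimal value of Transformed-MNL
with the modified weights `v'` over assortments `S ⊆ S⁺(v̄)` with `S ∈ 𝒳`
equals `R*_𝒳`, and `S*` attains it. -/
theorem stmt_8 (n : ℕ) (hn : 1 ≤ n) (r v : Fin n → ℝ)
    (hr : ∀ i, 0 < r i) (hv : ∀ i, 0 < v i)
    (α : ℝ) (hα0 : 0 < α) (hα1 : α ≤ 1)
    (𝒳 : Set (Finset (Fin n))) (hX : 𝒳.Nonempty)
    (vbar : ℝ) (hvbar : ∃ i, vbar = v i ∨ vbar = α * v i) (hvbarpos : 0 < vbar)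
    (Sstar : Finset (Fin n)) (hSX : Sstar ∈ 𝒳)
    (hSv : ∀ i ∈ Sstar, vbar ≤ v i)
    (hfeas : P6Feasible n v α 𝒳 (wStarC n r v α (RstarX n r v α 𝒳) vbar Sstar))
    (hval : ∑ i, (r i - RstarX n r v α 𝒳) *
        wStarC n r v α (RstarX n r v α 𝒳) vbar Sstar i = RstarX n r v α 𝒳) :
    sSup {val : ℝ | ∃ S : Finset (Fin n), (∀ i ∈ S, vbar ≤ v i) ∧ S ∈ 𝒳 ∧
        (∑ i ∈ S, r i * modW n r v α (RstarX n r v α 𝒳) vbar i) /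
          (1 + ∑ i ∈ S, modW n r v α (RstarX n r v α 𝒳) vbar i) = val} =
      RstarX n r v α 𝒳 ∧
    (∑ i ∈ Sstar, r i * modW n r v α (RstarX n r v α 𝒳) vbar i) /
        (1 + ∑ i ∈ Sstar, modW n r v α (RstarX n r v α 𝒳) vbar i) =
      RstarX n r v α 𝒳 := by
  set R := RstarX n r v α 𝒳
  have hatt : (∑ i ∈ Sstar, r i * modW n r v α R vbar i) /
      (1 + ∑ i ∈ Sstar, modW n r v α R vbar i) = R := by
    have hnonneg : 0 ≤ ∑ i ∈ Sstar, modW n r v α R vbar i := Finset.sum_nonneg fun i hi =>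
      hvbarpos.le.trans (modW_mem_Icc r v hα0 hα1 R hvbarpos (hSv i hi)).1
    have hsum : ∑ i ∈ Sstar, (r i - R) * modW n r v α R vbar i = R := by
      refine Eq.trans ?_ hval
      rw [← Finset.univ_inter Sstar, ← Finset.sum_ite_mem]
      refine Finset.sum_congr rfl fun i _ => ?_
      simp [wStarC, modW]
    simp only [sub_mul, Finset.sum_sub_distrib, ← Finset.mul_sum] at hsum
    rw [div_eq_iff (by linarith)]
    linarith
  refine ⟨IsGreatest.csSup_eq ⟨⟨Sstar, hSv, hSX, hatt⟩, ?_⟩, hatt⟩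
  rintro _ ⟨S, hS, hSX', rfl⟩
  exact transformed_revenue_le_RstarX n hn r v hr hv α hα0 hα1 𝒳 R vbar hvbarpos S hS hSX'
end
end

section
/- Fix n ≥ 1, revenues r_i > 0 and MNL preference weights v_i > 0 for i ∈ {1,…,n}, a balancing parameter α ∈ (0,1], and a nonempty collection 𝒳 of subsets of {1,…,n}. Let r̂ ∈ {r_1,…,r_n}, let v̂ ∈ {v_i : i} ∪ {α·v_i : i}, and define v'_i = v̂ if r_i < r̂ and v'_i = min{v_i, v̂/α} if r_i ≥ r̂. Let S be any subset of S⁺(v̂) = {i : v_i ≥ v̂} with S ∈ 𝒳, and define x by x_i = v'_i/(1 + ∑_{j∈S} v'_j) for i ∈ S, x_i = 0 for i ∉ S, and x_0 = 1/(1 + ∑_{j∈S} v'_j). Then x is BMS-C-feasible and {i : x_i > 0} = S. -/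
open Classical Finset

noncomputable section

theorem le_modW {n : ℕ} (r : Fin n → ℝ) {v : Fin n → ℝ} {α : ℝ} (R : ℝ) {vbar : ℝ} {i : Fin n}
    (hα0 : 0 < α) (hα1 : α ≤ 1) (hvbar : 0 ≤ vbar) (hi : vbar ≤ v i) :
    vbar ≤ modW n r v α R vbar i := by
  unfold modW
  split_ifs
  · exact le_min hi (le_div_self hvbar hα0 hα1)
  · exact le_rfl

theorem modW_le {n : ℕ} (r : Fin n → ℝ) {v : Fin n → ℝ} (α R : ℝ) {vbar : ℝ} {i : Fin n}
    (hi : vbar ≤ v i) : modW n r v α R vbar i ≤ v i := by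
  unfold modW
  split_ifs
  · exact min_le_left _ _
  · exact hi

theorem mul_modW_le {n : ℕ} (r v : Fin n → ℝ) {α : ℝ} (R : ℝ) {vbar : ℝ} (i : Fin n)
    (hα0 : 0 < α) (hα1 : α ≤ 1) (hvbar : 0 ≤ vbar) :
    α * modW n r v α R vbar i ≤ vbar := by
  unfold modW
  split_ifs
  · exact (mul_le_mul_of_nonneg_left (min_le_right _ _) hα0.le).trans_eq
      (mul_div_cancel₀ _ hα0.ne')
  · exact mul_le_of_le_one_left hvbar hα1

/-- the candidate solution constructed in Algorithm 1 from any
guess `(r̂, v̂)` and any assortment `S ⊆ S⁺(v̂)` with `S ∈ 𝒳` is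
BMS-C-feasible, and its support is exactly `S`. -/
theorem stmt_9 (n : ℕ) (hn : 1 ≤ n) (r v : Fin n → ℝ)
    (hr : ∀ i, 0 < r i) (hv : ∀ i, 0 < v i)
    (α : ℝ) (hα0 : 0 < α) (hα1 : α ≤ 1)
    (𝒳 : Set (Finset (Fin n))) (hX : 𝒳.Nonempty)
    (rhat : ℝ) (hrhat : ∃ i, rhat = r i)
    (vhat : ℝ) (hvhat : ∃ i, vhat = v i ∨ vhat = α * v i)
    (S : Finset (Fin n)) (hSv : ∀ i ∈ S, vhat ≤ v i) (hSX : S ∈ 𝒳) :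
    BMSCFeasible n v α 𝒳
      (1 / (1 + ∑ j ∈ S, modW n r v α rhat vhat j))
      (fun i => if i ∈ S then
        modW n r v α rhat vhat i / (1 + ∑ j ∈ S, modW n r v α rhat vhat j)
        else 0) ∧
    suppF n (fun i => if i ∈ S then
        modW n r v α rhat vhat i / (1 + ∑ j ∈ S, modW n r v α rhat vhat j)
        else 0) = S := by
  have hvhat0 : 0 < vhat := by
    obtain ⟨i, rfl | rfl⟩ := hvhat
    · exact hv i
    · exact mul_pos hα0 (hv i)
  have hlow : ∀ i ∈ S, vhat ≤ modW n r v α rhat vhat i := fun i hi =>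
    le_modW r rhat hα0 hα1 hvhat0.le (hSv i hi)
  have hpos : ∀ i ∈ S, 0 < modW n r v α rhat vhat i := fun i hi =>
    hvhat0.trans_le (hlow i hi)
  have hD : 0 < 1 + ∑ j ∈ S, modW n r v α rhat vhat j :=
    add_pos_of_pos_of_nonneg one_pos (Finset.sum_nonneg fun i hi => (hpos i hi).le)
  set D := 1 + ∑ j ∈ S, modW n r v α rhat vhat j with hDdef
  have hsupp : suppF n (fun i => if i ∈ S then modW n r v α rhat vhat i / D else 0) = S := by
    ext i
    by_cases hi : i ∈ S
    · simp [suppF, hi, div_pos (hpos i hi) hD]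
    · simp [suppF, hi]
  refine ⟨⟨⟨?_, fun i => ?_, fun i => ?_⟩, hsupp.symm ▸ hSX⟩, hsupp⟩
  · rw [Finset.sum_ite_mem, Finset.univ_inter, ← Finset.sum_div, ← add_div, ← hDdef,
      div_self hD.ne']
  · by_cases hi : i ∈ S
    · simp only [hi, if_true, mul_one_div]
      exact ⟨(div_pos (hpos i hi) hD).le,
        div_le_div_of_nonneg_right (modW_le r α rhat (hSv i hi)) hD.le⟩
    · simp only [hi, if_false]
      exact ⟨le_rfl, mul_nonneg (hv i).le (one_div_pos.2 hD).le⟩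
  · by_cases hi : i ∈ S
    · right
      intro j
      by_cases hj : j ∈ S
      · simp only [hi, hj, if_true, ← mul_div_assoc]
        exact div_le_div_of_nonneg_right
          ((mul_modW_le r v rhat j hα0 hα1 hvhat0.le).trans (hlow i hi)) hD.le
      · simp only [hi, hj, if_true, if_false, mul_zero]
        exact (div_pos (hpos i hi) hD).le
    · simp [hi]
end
end

section
/- Fix n ≥ 1, revenues r_i > 0 and MNL preference weights v_i > 0 for i ∈ {1,…,n}, a balancing parameter α ∈ (0,1], a nonempty collection 𝒳 of subsets of {1,…,n}, and β ∈ (0,1]. Suppose v̄ > 0 and S* ∈ 𝒳 satisfy the conditions of the structural lemma for Problem (6) (v̄ ∈ {v_i : i} ∪ {α·v_i : i}, v_i ≥ v̄ for all i ∈ S*, and the vector w* defined by w*_i = min{v_i, v̄/α} if i ∈ S* and r_i ≥ R*_𝒳, w*_i = v̄ if i ∈ S* and r_i < R*_𝒳, w*_i = 0 if i ∉ S*, is Problem-(6)-feasible with ∑_{i=1}^n (r_i − R*_𝒳)·w*_i = R*_𝒳). Define v'_i = v̄ if r_i < R*_𝒳 and v'_i = min{v_i, v̄/α} if r_i ≥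 R*_𝒳. Let S ⊆ S⁺(v̄) = {i : v_i ≥ v̄} with S ∈ 𝒳 satisfy (∑_{i∈S} r_i v'_i)/(1 + ∑_{i∈S} v'_i) ≥ β·R*_𝒳, and define x by x_i = v'_i/(1 + ∑_{j∈S} v'_j) for i ∈ S, x_i = 0 for i ∉ S, and x_0 = 1/(1 + ∑_{j∈S} v'_j). Then x is BMS-C-feasible and ∑_{i=1}^n r_i x_i ≥ β·R*_𝒳. -/
open Classical Finset

noncomputable section

/-- Normalizing weights `w` with `w i ∈ [vbar, min (v i) (vbar / α)]` on an admissible assortment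
`S` gives a BMS-C-feasible vector. -/
theorem bmscFeasible_normalize {n : ℕ} {v w : Fin n → ℝ} {α vbar : ℝ} (hv : ∀ i, 0 ≤ v i)
    (hvbar : 0 < vbar) {𝒳 : Set (Finset (Fin n))} {S : Finset (Fin n)} (hS : S ∈ 𝒳)
    (hlow : ∀ i ∈ S, vbar ≤ w i) (hup : ∀ i ∈ S, w i ≤ v i) (hbal : ∀ i ∈ S, α * w i ≤ vbar) :
    BMSCFeasible n v α 𝒳 (1 / (1 + ∑ j ∈ S, w j))
      (fun i => if i ∈ S then w i / (1 + ∑ j ∈ S, w j) else 0) := by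
  have hpos : ∀ i ∈ S, 0 < w i := fun i hi => hvbar.trans_le (hlow i hi)
  have hD : 0 < 1 + ∑ j ∈ S, w j := by
    have := Finset.sum_nonneg fun i hi => (hpos i hi).le
    linarith
  refine ⟨⟨?_, fun i => ?_, fun i => ?_⟩, ?_⟩
  · rw [Finset.sum_ite_mem, Finset.univ_inter, ← Finset.sum_div, ← add_div, div_self hD.ne']
  · by_cases hi : i ∈ S
    · simp only [hi, if_true, mul_one_div]
      exact ⟨(div_pos (hpos i hi) hD).le, div_le_div_of_nonneg_right (hup i hi) hD.le⟩
    · simpa only [hi, if_false, le_refl, true_and] using mul_nonneg (hv i) (one_div_pos.2 hD).le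
  · by_cases hi : i ∈ S
    · refine Or.inr fun j => ?_
      by_cases hj : j ∈ S
      · simp only [hi, hj, if_true, ← mul_div_assoc]
        exact div_le_div_of_nonneg_right ((hbal j hj).trans (hlow i hi)) hD.le
      · simpa only [hi, hj, if_true, if_false, mul_zero] using (div_pos (hpos i hi) hD).le
    · exact Or.inl (if_neg hi)
  · convert hS
    ext i
    by_cases hi : i ∈ S
    · simpa [suppF, hi] using div_pos (hpos i hi) hD
    · simp [suppF, hi]

/-- under the conditions of the structural lemma for
Problem (6), any `β`-approximate assortment `S` for Transformed-MNL yields a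
BMS-C-feasible solution whose revenue is at least `β·R*_𝒳`. -/
theorem stmt_10 (n : ℕ) (hn : 1 ≤ n) (r v : Fin n → ℝ)
    (hr : ∀ i, 0 < r i) (hv : ∀ i, 0 < v i)
    (α : ℝ) (hα0 : 0 < α) (hα1 : α ≤ 1)
    (𝒳 : Set (Finset (Fin n))) (hX : 𝒳.Nonempty)
    (β : ℝ) (hβ0 : 0 < β) (hβ1 : β ≤ 1)
    (vbar : ℝ) (hvbar : ∃ i, vbar = v i ∨ vbar = α * v i) (hvbarpos : 0 < vbar)
    (Sstar : Finset (Fin n)) (hSX : Sstar ∈ 𝒳)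
    (hSv : ∀ i ∈ Sstar, vbar ≤ v i)
    (hfeas : P6Feasible n v α 𝒳 (wStarC n r v α (RstarX n r v α 𝒳) vbar Sstar))
    (hval : ∑ i, (r i - RstarX n r v α 𝒳) *
        wStarC n r v α (RstarX n r v α 𝒳) vbar Sstar i = RstarX n r v α 𝒳)
    (S : Finset (Fin n)) (hSv' : ∀ i ∈ S, vbar ≤ v i) (hSX' : S ∈ 𝒳)
    (happrox : β * RstarX n r v α 𝒳 ≤
      (∑ i ∈ S, r i * modW n r v α (RstarX n r v α 𝒳) vbar i) /
        (1 + ∑ i ∈ S, modW n r v α (RstarX n r v α 𝒳) vbar i)) :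
    BMSCFeasible n v α 𝒳
      (1 / (1 + ∑ j ∈ S, modW n r v α (RstarX n r v α 𝒳) vbar j))
      (fun i => if i ∈ S then
        modW n r v α (RstarX n r v α 𝒳) vbar i /
          (1 + ∑ j ∈ S, modW n r v α (RstarX n r v α 𝒳) vbar j)
        else 0) ∧
    β * RstarX n r v α 𝒳 ≤
      ∑ i, r i * (if i ∈ S then
        modW n r v α (RstarX n r v α 𝒳) vbar i /
          (1 + ∑ j ∈ S, modW n r v α (RstarX n r v α 𝒳) vbar j)
        else 0) := by
  have hα : vbar ≤ vbar / α := le_div_self hvbarpos.le hα0 hα1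
  refine ⟨bmscFeasible_normalize (fun i => (hv i).le) hvbarpos hSX' (fun i hi => ?_)
    (fun i hi => ?_) (fun i hi => ?_), ?_⟩
  · unfold modW
    split_ifs
    exacts [le_min (hSv' i hi) hα, le_rfl]
  · unfold modW
    split_ifs
    exacts [min_le_left _ _, hSv' i hi]
  · rw [mul_comm, ← le_div_iff₀ hα0]
    unfold modW
    split_ifs
    exacts [min_le_right _ _, hα]
  · simpa only [mul_ite, mul_zero, Finset.sum_ite_mem, Finset.univ_inter, ← mul_div_assoc,
      ← Finset.sum_div] using happrox
end
end

section
/- Let m ≥ 2 be an integer, let a_1,…,a_{2m} be positive integers with ∑_{i=1}^{2m} a_i = 2Q for a positive integer Q. Define ε = 1/(4mQ), M = 10m²/ε², B = 2M − m − εQ, and consider the Upper-Bound instance with n = 2m+1 products, balancing parameter α = 1/2, revenues r_i = B − (1+ε·a_i)/(1+ε²·a_i) and weights v_i = 1 + ε²·a_i for i ∈ {1,…,2m}, r_{2m+1} = M + B and v_{2m+1} = 2, where T is any positive integer such that T·2/(3+m+ε²Q) is a positive integer, c_i = T for i ∈ {1,…,2m}, and c_{2m+1} = T·2/(3+m+ε²Q).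 Then the optimal value of the Upper-Bound problem for this instance is at least T·B if and only if there exists A ⊆ {1,…,2m} with |A| = m and ∑_{i∈A} a_i = Q. -/
open Classical Finset

noncomputable section

/-- A vector `(x0, x)` is UB-feasible: it is BMS-feasible and additionally
`x i ≤ c i / T` for every product. -/
def UBFeasible (n : ℕ) (v : Fin n → ℝ) (α : ℝ) (T : ℕ) (c : Fin n → ℕ)
    (x0 : ℝ) (x : Fin n → ℝ) : Prop :=
  BMSFeasible n v α x0 x ∧ ∀ i, x i ≤ (c i : ℝ) / (T : ℝ)

/-- Optimal value of the Upper-Bound problem. -/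
def UBopt (n : ℕ) (r v : Fin n → ℝ) (α : ℝ) (T : ℕ) (c : Fin n → ℕ) : ℝ :=
  sSup {R | ∃ x0 x, UBFeasible n v α T c x0 x ∧ (T : ℝ) * ∑ i, r i * x i = R}

theorem isCompact_setOf_ubFeasible (n : ℕ) (v : Fin n → ℝ) (α : ℝ) (T : ℕ) (c : Fin n → ℕ) :
    IsCompact {p : ℝ × (Fin n → ℝ) | UBFeasible n v α T c p.1 p.2} := by
  have hcoord (i : Fin n) : Continuous fun p : ℝ × (Fin n → ℝ) => p.2 i := by fun_prop
  have hclosed : IsClosed {p : ℝ × (Fin n → ℝ) | UBFeasible n v α T c p.1 p.2} := by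
    simp only [UBFeasible, BMSFeasible, Set.ofPred_and, Set.ofPred_forall, Set.ofPred_or]
    refine (((isClosed_eq (by fun_prop) (by fun_prop)).inter
      ((isClosed_iInter fun i => (isClosed_le (by fun_prop) (hcoord i)).inter
        (isClosed_le (hcoord i) (by fun_prop))).inter
      (isClosed_iInter fun i => (isClosed_eq (hcoord i) (by fun_prop)).union
        (isClosed_iInter fun j => isClosed_le (by fun_prop) (hcoord i))))).inter
      (isClosed_iInter fun i => isClosed_le (hcoord i) (by fun_prop)))
  refine ((isCompact_Icc (a := (1 - ∑ i, (c i : ℝ) / T)) (b := (1 : ℝ))).prod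
    (isCompact_Icc (a := (0 : Fin n → ℝ)) (b := fun i => (c i : ℝ) / T))).of_isClosed_subset
    hclosed ?_
  rintro ⟨x0, x⟩ ⟨⟨h1, h2, -⟩, h4⟩
  have hn : 0 ≤ ∑ i, x i := Finset.sum_nonneg fun i _ => (h2 i).1
  have hle : ∑ i, x i ≤ ∑ i, (c i : ℝ) / T := Finset.sum_le_sum fun i _ => h4 i
  exact ⟨⟨by dsimp only at *; linarith, by dsimp only at *; linarith⟩, fun i => (h2 i).1, h4⟩

theorem isCompact_setOf_ubValue (n : ℕ) (r v : Fin n → ℝ) (α : ℝ) (T : ℕ) (c : Fin n → ℕ) :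
    IsCompact {R | ∃ x0 x, UBFeasible n v α T c x0 x ∧ (T : ℝ) * ∑ i, r i * x i = R} := by
  convert (isCompact_setOf_ubFeasible n v α T c).image
    (f := fun p : ℝ × (Fin n → ℝ) => (T : ℝ) * ∑ i, r i * p.2 i) (by fun_prop) using 1
  ext R
  simp

/-- The Upper-Bound problem has an optimal solution, so its value reaches a threshold
exactly when some feasible vector does. -/
theorem le_ubOpt_iff (n : ℕ) (r v : Fin n → ℝ) (hv : ∀ i, 0 ≤ v i) (α : ℝ) (T : ℕ)
    (c : Fin n → ℕ) (b : ℝ) :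
    b ≤ UBopt n r v α T c ↔
      ∃ x0 x, UBFeasible n v α T c x0 x ∧ b ≤ (T : ℝ) * ∑ i, r i * x i := by
  have hK := isCompact_setOf_ubValue n r v α T c
  constructor
  · intro h
    have hne : {R | ∃ x0 x, UBFeasible n v α T c x0 x ∧
        (T : ℝ) * ∑ i, r i * x i = R}.Nonempty :=
      ⟨_, 1, 0, ⟨⟨by simp, by simpa using hv, by simp⟩, fun i => by simp; positivity⟩, rfl⟩
    obtain ⟨x0, x, hx, hR⟩ := hK.sSup_mem hne
    exact ⟨x0, x, hx, hR ▸ h⟩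
  · rintro ⟨x0, x, hx, h⟩
    exact h.trans (le_csSup hK.bddAbove ⟨x0, x, hx, rfl⟩)

/-- Linear lower bound on the ratio of the price and weight perturbations. -/
theorem one_add_sub_le_div {ε t : ℝ} (ht : 0 ≤ t) (hεt : ε * t ≤ 1 / 4) :
    1 + ε * t - 5 / 4 * ε ^ 2 * t ≤ (1 + ε * t) / (1 + ε ^ 2 * t) := by
  have h : 0 ≤ ε ^ 2 * t := by positivity
  rw [le_div_iff₀ (by linarith)]
  nlinarith [mul_nonneg h h, mul_le_mul_of_nonneg_left hεt h]

set_option maxHeartbeats 800000 in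
/-- A set of items whose purchase probabilities `x` meet both the revenue requirement and the
capacity requirement has exactly `m` elements of total weight `Q`. -/
theorem card_eq_and_sum_eq {ι : Type*} (S : Finset ι) (a : ι → ℕ) (x : ι → ℝ) (m Q : ℕ)
    (hm : 2 ≤ m) (hQ : 0 < Q) (haS : ∑ i ∈ S, a i ≤ 2 * Q)
    {ε M B z δ : ℝ} (hε : ε = 1 / (4 * (m : ℝ) * (Q : ℝ)))
    (hM : M = 10 * (m : ℝ) ^ 2 / ε ^ 2) (hB : B = 2 * M - (m : ℝ) - ε * (Q : ℝ))
    (hz : 0 < z) (hδ : 0 ≤ δ) (hzx : ∀ i ∈ S, z ≤ x i)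
    (hxz : ∀ i ∈ S, x i ≤ (1 + ε ^ 2 * (a i : ℝ)) * (z + δ))
    (hrev : B * δ + ∑ i ∈ S, (1 + ε * (a i : ℝ)) / (1 + ε ^ 2 * (a i : ℝ)) * x i ≤
      (m + ε * Q) * z)
    (hcap : (m + ε ^ 2 * Q) * z - δ ≤ ∑ i ∈ S, x i) :
    S.card = m ∧ ∑ i ∈ S, a i = Q := by
  have hm' : (2 : ℝ) ≤ m := by exact_mod_cast hm
  have hQ' : (1 : ℝ) ≤ Q := by exact_mod_cast hQ
  have hε0 : 0 < ε := by rw [hε]; positivity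
  have hεmQ : ε * m * Q = 1 / 4 := by rw [hε]; field_simp
  have hεQ : ε * Q ≤ 1 / 8 := by
    nlinarith [mul_le_mul_of_nonneg_right hm' (by positivity : 0 ≤ ε * Q)]
  have hε8 : ε ≤ 1 / 8 := by nlinarith
  set P : ℝ := ∑ i ∈ S, (a i : ℝ) with hP
  have hP0 : 0 ≤ P := Finset.sum_nonneg fun i _ => by positivity
  have hP2 : P ≤ 2 * Q := by rw [hP]; exact_mod_cast haS
  have hai (i) (hi : i ∈ S) : ε * (a i : ℝ) ≤ 1 / 4 := by
    have h : (a i : ℝ) ≤ P :=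
      Finset.single_le_sum (f := fun i => (a i : ℝ)) (fun i _ => by positivity) hi
    nlinarith
  have hMε : ε ^ 2 * M = 10 * (m : ℝ) ^ 2 := by rw [hM]; field_simp
  have hBε : 19 * (m : ℝ) ^ 2 ≤ ε ^ 2 * B := by
    have h : ε ^ 2 * B = 20 * (m : ℝ) ^ 2 - ε ^ 2 * (m + ε * Q) := by
      rw [hB]; linear_combination 2 * hMε
    have h' : ε ^ 2 ≤ 1 := by nlinarith
    nlinarith [mul_le_mul_of_nonneg_right h' (by positivity : 0 ≤ m + ε * Q)]
  have hB0 : 0 ≤ B := by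
    by_contra! h
    nlinarith [mul_neg_of_pos_of_neg (pow_pos hε0 2) h]
  have hεP : ε * P ≤ 1 / 4 := by nlinarith
  have hε2P : ε ^ 2 * P ≤ 1 / 32 := by nlinarith
  have hratio : (S.card + ε * P - 5 / 4 * ε ^ 2 * P) * z ≤
      ∑ i ∈ S, (1 + ε * (a i : ℝ)) / (1 + ε ^ 2 * (a i : ℝ)) * x i := by
    have h : (S.card + ε * P - 5 / 4 * ε ^ 2 * P) * z =
        ∑ i ∈ S, (1 + ε * (a i : ℝ) - 5 / 4 * ε ^ 2 * (a i : ℝ)) * z := by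
      rw [← Finset.sum_mul, Finset.sum_sub_distrib, Finset.sum_add_distrib, ← Finset.mul_sum,
        ← Finset.mul_sum]
      simp [hP]
    rw [h]
    refine Finset.sum_le_sum fun i hi => ?_
    exact mul_le_mul (one_add_sub_le_div (by positivity) (hai i hi)) (hzx i hi) hz.le
      (by positivity)
  have hsize : S.card + ε * P - 5 / 4 * ε ^ 2 * P ≤ m + ε * Q := by
    refine le_of_mul_le_mul_right ?_ hz
    linarith [mul_nonneg hB0 hδ]
  have hcard0 : (0 : ℝ) ≤ S.card := by positivity
  have hεP' : 5 / 4 * ε ^ 2 * P ≤ ε * P := by nlinarith [mul_nonneg hε0.le hP0]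
  have hle : S.card ≤ m := by
    have h : (S.card : ℝ) < m + 1 := by linarith
    exact Nat.lt_succ_iff.mp (by exact_mod_cast h)
  have hle' : (S.card : ℝ) ≤ m := by exact_mod_cast hle
  have hBδ : B * δ ≤ (m + 1 / 8) * z := by
    have : 0 ≤ (S.card + ε * P - 5 / 4 * ε ^ 2 * P) * z := mul_nonneg (by linarith) hz.le
    nlinarith
  have hδz : 19 * (m : ℝ) ^ 2 * δ ≤ ε ^ 2 * ((m + 1 / 8) * z) := by
    have h₁ := mul_le_mul_of_nonneg_right hBε hδ
    have h₂ := mul_le_mul_of_nonneg_left hBδ (sq_nonneg ε)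
    linarith
  have hδ' : (m + 9 / 8) * δ ≤ 2 / 19 * ε ^ 2 * z := by
    have h₁ : ((m : ℝ) + 9 / 8) * (m + 1 / 8) ≤ 2 * (m : ℝ) ^ 2 := by
      nlinarith only [hm']
    have h₂ := mul_le_mul_of_nonneg_left hδz (by positivity : (0 : ℝ) ≤ m + 9 / 8)
    have h₃ := mul_le_mul_of_nonneg_right h₁ (by positivity : 0 ≤ ε ^ 2 * z)
    have hm2 : (0 : ℝ) < (m : ℝ) ^ 2 := by positivity
    refine le_of_mul_le_mul_left ?_ hm2
    linarith
  have hupper : ∑ i ∈ S, x i ≤ (S.card + ε ^ 2 * P) * (z + δ) := by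
    have h : (S.card + ε ^ 2 * P) * (z + δ) =
        ∑ i ∈ S, (1 + ε ^ 2 * (a i : ℝ)) * (z + δ) := by
      rw [← Finset.sum_mul, Finset.sum_add_distrib, ← Finset.mul_sum]
      simp [hP]
    rw [h]
    exact Finset.sum_le_sum hxz
  have hlower : m + ε ^ 2 * Q ≤ S.card + ε ^ 2 * P + 2 / 19 * ε ^ 2 := by
    refine le_of_mul_le_mul_right ?_ hz
    have h : (S.card + ε ^ 2 * P + 1) * δ ≤ (m + 9 / 8) * δ :=
      mul_le_mul_of_nonneg_right (by linarith) hδ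
    linarith
  have hge : m ≤ S.card := by
    have h : (m : ℝ) < S.card + 1 := by
      have : 0 ≤ ε ^ 2 * Q := by positivity
      nlinarith
    exact Nat.lt_succ_iff.mp (by exact_mod_cast h)
  have hcard : S.card = m := le_antisymm hle hge
  have hcard' : (S.card : ℝ) = m := by exact_mod_cast hcard
  refine ⟨hcard, le_antisymm ?_ ?_⟩
  · have h : P < Q + 1 := by
      refine lt_of_mul_lt_mul_left ?_ hε0.le
      nlinarith
    rw [hP] at h
    exact Nat.lt_succ_iff.mp (by exact_mod_cast h)
  · have h : Q < P + 1 := by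
      refine lt_of_mul_lt_mul_left ?_ (sq_nonneg ε)
      nlinarith [sq_pos_of_pos hε0]
    rw [hP] at h
    exact Nat.lt_succ_iff.mp (by exact_mod_cast h)

/-- NP-hardness reduction: the Upper-Bound instance built from a
cardinality-constrained subset-sum instance has optimal value at least `T·B`
iff there is a subset `A` of size `m` with `∑_{i∈A} a_i = Q`. -/
theorem stmt_12 (m Q : ℕ) (hm : 2 ≤ m) (hQ : 0 < Q)
    (a : Fin (2 * m) → ℕ) (ha : ∀ i, 0 < a i) (hsum : ∑ i, a i = 2 * Q)
    (ε M B : ℝ)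
    (hε : ε = 1 / (4 * (m : ℝ) * (Q : ℝ)))
    (hM : M = 10 * (m : ℝ) ^ 2 / ε ^ 2)
    (hB : B = 2 * M - (m : ℝ) - ε * (Q : ℝ))
    (r v : Fin (2 * m + 1) → ℝ)
    (hr : ∀ i : Fin (2 * m),
      r i.castSucc = B - (1 + ε * (a i : ℝ)) / (1 + ε ^ 2 * (a i : ℝ)))
    (hv : ∀ i : Fin (2 * m), v i.castSucc = 1 + ε ^ 2 * (a i : ℝ))
    (hrlast : r (Fin.last (2 * m)) = M + B)
    (hvlast : v (Fin.last (2 * m)) = 2)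
    (T : ℕ) (hT : 0 < T)
    (c : Fin (2 * m + 1) → ℕ)
    (hc : ∀ i : Fin (2 * m), c i.castSucc = T)
    (hclastpos : 0 < c (Fin.last (2 * m)))
    (hclast : (c (Fin.last (2 * m)) : ℝ) =
      (T : ℝ) * (2 / (3 + (m : ℝ) + ε ^ 2 * (Q : ℝ)))) :
    (T : ℝ) * B ≤ UBopt (2 * m + 1) r v (1 / 2) T c ↔
      ∃ A : Finset (Fin (2 * m)), A.card = m ∧ ∑ i ∈ A, a i = Q := by
  have hm' : (2 : ℝ) ≤ m := by exact_mod_cast hm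
  have hQ' : (1 : ℝ) ≤ Q := by exact_mod_cast hQ
  have hT' : (0 : ℝ) < T := by exact_mod_cast hT
  have hε0 : 0 < ε := by rw [hε]; positivity
  have hεmQ : ε * m * Q = 1 / 4 := by rw [hε]; field_simp
  have hεQ : ε * Q ≤ 1 / 8 := by
    nlinarith [mul_le_mul_of_nonneg_right hm' (by positivity : 0 ≤ ε * Q)]
  have hε8 : ε ≤ 1 / 8 := by nlinarith
  have hN : 0 < 3 + (m : ℝ) + ε ^ 2 * (Q : ℝ) := by positivity
  have hM0 : 10 * (m : ℝ) ^ 2 ≤ M := by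
    rw [hM]
    exact le_div_self (by positivity) (by positivity) (by nlinarith)
  have hB0 : 0 < B := by rw [hB]; nlinarith
  have hv0 (i) : 0 ≤ v i := by
    induction i using Fin.lastCases with
    | last => rw [hvlast]; norm_num
    | cast i => rw [hv]; positivity
  have hai (i) : ε ^ 2 * (a i : ℝ) ≤ 1 := by
    have h : a i ≤ 2 * Q := hsum ▸ Finset.single_le_sum (fun _ _ => Nat.zero_le _) (mem_univ i)
    have h' : (a i : ℝ) ≤ 2 * Q := by exact_mod_cast h
    nlinarith
  have hclast' : (c (Fin.last (2 * m)) : ℝ) / T = 2 / (3 + (m : ℝ) + ε ^ 2 * (Q : ℝ)) := by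
    rw [hclast]; field_simp
  have hc' (i : Fin (2 * m)) : (c i.castSucc : ℝ) / T = 1 := by
    rw [hc]; exact div_self hT'.ne'
  rw [le_ubOpt_iff _ _ _ hv0]
  simp only [mul_le_mul_iff_right₀ hT', Fin.sum_univ_castSucc, hr, hrlast]
  constructor
  · rintro ⟨x0, x, ⟨⟨h1, h2, h3⟩, h4⟩, hobj⟩
    rw [Fin.sum_univ_castSucc] at h1
    set y := x (Fin.last (2 * m)) with hy
    have hy0 : 0 ≤ y := (h2 _).1
    have hyx0 : y ≤ 2 * x0 := hvlast ▸ (h2 (Fin.last (2 * m))).2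
    have hyN : y * (3 + (m : ℝ) + ε ^ 2 * (Q : ℝ)) ≤ 2 := by
      have h := h4 (Fin.last (2 * m))
      rwa [hclast', le_div_iff₀ hN] at h
    have hx (i : Fin (2 * m)) : 0 ≤ x i.castSucc := (h2 _).1
    simp only [sub_mul, Finset.sum_sub_distrib, ← Finset.mul_sum] at hobj
    set W := ∑ i : Fin (2 * m),
      (1 + ε * (a i : ℝ)) / (1 + ε ^ 2 * (a i : ℝ)) * x i.castSucc with hW
    have hrev : B * x0 + W ≤ M * y := by
      linear_combination hobj + B * h1
    have hxW : ∑ i : Fin (2 * m), x i.castSucc ≤ W := by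
      refine Finset.sum_le_sum fun i _ => ?_
      refine le_mul_of_one_le_left (hx i) ?_
      rw [one_le_div (by positivity)]
      have : 0 ≤ ε * (a i : ℝ) := by positivity
      nlinarith
    have hypos : 0 < y := by
      rcases hy0.lt_or_eq with h | h
      · exact h
      · exfalso
        rw [← h] at hrev hyx0 h1
        have hs : 0 ≤ ∑ i : Fin (2 * m), x i.castSucc := Finset.sum_nonneg fun i _ => hx i
        have h0 : 0 ≤ x0 := by linarith
        have h0' : 0 ≤ B * x0 := by positivity
        have h0'' : B * x0 ≤ 0 := by linarith
        have : x0 ≤ 0 := nonpos_of_mul_nonpos_right h0'' hB0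
        linarith
    refine ⟨univ.filter fun i : Fin (2 * m) => x i.castSucc ≠ 0, ?_⟩
    refine card_eq_and_sum_eq _ a (fun i => x i.castSucc) m Q hm hQ
      (hsum ▸ Finset.sum_le_sum_of_subset (filter_subset _ _)) hε hM hB
      (z := y / 2) (δ := x0 - y / 2) (by linarith) (by linarith) ?_ ?_ ?_ ?_
    · intro i hi
      have h := (h3 i.castSucc).resolve_left (mem_filter.mp hi).2 (Fin.last (2 * m))
      linarith
    · intro i _
      have h := (h2 i.castSucc).2
      rw [hv] at h
      simpa using h
    · have h : ∑ i ∈ univ.filter fun i : Fin (2 * m) => x i.castSucc ≠ 0,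
          (1 + ε * (a i : ℝ)) / (1 + ε ^ 2 * (a i : ℝ)) * x i.castSucc = W :=
        Finset.sum_filter_of_ne fun i _ hi => right_ne_zero_of_mul hi
      rw [h]
      rw [hB] at hrev ⊢
      linarith
    · rw [Finset.sum_filter_ne_zero]
      linarith
  · rintro ⟨A, hA, hAQ⟩
    set N : ℝ := 3 + (m : ℝ) + ε ^ 2 * (Q : ℝ) with hNdef
    have hAQ' : ∑ i ∈ A, (a i : ℝ) = Q := by exact_mod_cast hAQ
    have hA' : (A.card : ℝ) = m := by exact_mod_cast hA
    let x : Fin (2 * m + 1) → ℝ :=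
      Fin.snoc (fun i => if i ∈ A then (1 + ε ^ 2 * (a i : ℝ)) / N else 0) (2 / N)
    have hxl : x (Fin.last (2 * m)) = 2 / N := by simp [x]
    have hxc (i : Fin (2 * m)) :
        x i.castSucc = if i ∈ A then (1 + ε ^ 2 * (a i : ℝ)) / N else 0 := by simp [x]
    have hmax (j) : x j ≤ 2 / N := by
      induction j using Fin.lastCases with
      | last => rw [hxl]
      | cast j =>
        rw [hxc]
        split_ifs
        · exact div_le_div_of_nonneg_right (by linarith [hai j]) hN.le
        · positivity
    have hN2 : 2 / N ≤ 1 := by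
      rw [div_le_one hN]
      have : 0 ≤ ε ^ 2 * (Q : ℝ) := by positivity
      linarith
    have hsumA : ∑ i ∈ A, (1 + ε ^ 2 * (a i : ℝ)) = m + ε ^ 2 * Q := by
      rw [Finset.sum_add_distrib, ← Finset.mul_sum, hAQ']
      simp [hA']
    have hsumx : ∑ i : Fin (2 * m), x i.castSucc = (m + ε ^ 2 * Q) / N := by
      simp only [hxc, Finset.sum_ite_mem, univ_inter, ← Finset.sum_div, hsumA]
    have hsumw : ∑ i : Fin (2 * m),
        (1 + ε * (a i : ℝ)) / (1 + ε ^ 2 * (a i : ℝ)) * x i.castSucc = (m + ε * Q) / N := by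
      have h (i : Fin (2 * m)) :
          (1 + ε * (a i : ℝ)) / (1 + ε ^ 2 * (a i : ℝ)) * x i.castSucc =
            if i ∈ A then (1 + ε * (a i : ℝ)) / N else 0 := by
        rw [hxc]
        split_ifs
        · field_simp
        · simp
      simp only [h, Finset.sum_ite_mem, univ_inter, ← Finset.sum_div, Finset.sum_add_distrib,
        ← Finset.mul_sum, hAQ']
      simp [hA']
    refine ⟨1 / N, x, ⟨⟨?_, fun i => ?_, fun i => ?_⟩, fun i => ?_⟩, ?_⟩
    · rw [Fin.sum_univ_castSucc, hsumx, hxl, ← add_div, ← add_div, div_eq_one_iff_eq hN.ne']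
      rw [hNdef]; ring
    · induction i using Fin.lastCases with
      | last => rw [hxl, hvlast]; exact ⟨by positivity, by rw [mul_one_div]⟩
      | cast i =>
        rw [hxc, hv]
        split_ifs
        · exact ⟨by positivity, by rw [mul_one_div]⟩
        · exact ⟨le_rfl, by positivity⟩
    · induction i using Fin.lastCases with
      | last =>
        refine Or.inr fun j => ?_
        have : 0 < 2 / N := by positivity
        rw [hxl]
        linarith [hmax j]
      | cast i =>
        rw [hxc]
        split_ifs
        · refine Or.inr fun j => ?_
          have h : 1 / N ≤ (1 + ε ^ 2 * (a i : ℝ)) / N :=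
            div_le_div_of_nonneg_right (le_add_of_nonneg_right (by positivity)) hN.le
          have h' : 2 / N = 2 * (1 / N) := by ring
          linarith [hmax j]
        · exact Or.inl rfl
    · induction i using Fin.lastCases with
      | last => rw [hxl, hclast']
      | cast i => rw [hc']; exact (hmax _).trans hN2
    · simp only [sub_mul, Finset.sum_sub_distrib, ← Finset.mul_sum]
      rw [hsumx, hsumw, hxl]
      refine le_of_eq ?_
      field_simp
      rw [hNdef, hB]
      ring
end
end

section
/- Fix n ≥ 1, revenues r_i > 0, MNL preference weights v_i > 0, a balancing parameter α ∈ (0,1], a horizon T ∈ ℤ⁺, and inventories c_i ∈ ℤ⁺. Then every UB-feasible vector x* that attains the optimal value of the Upper-Bound problem satisfies: there exists i ∈ {1,…,n} such that either x*_i = c_i/T or x*_i = v_i·x*_0. -/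
open Classical Finset

noncomputable section

/-- The objective values of UB-feasible vectors are bounded above. -/
theorem bddAbove_UBFeasible_values (n : ℕ) (r v : Fin n → ℝ) (hr : ∀ i, 0 < r i)
    (α : ℝ) (T : ℕ) (c : Fin n → ℕ) :
    BddAbove {R | ∃ x0 x, UBFeasible n v α T c x0 x ∧ (T : ℝ) * ∑ i, r i * x i = R} := by
  refine ⟨(T : ℝ) * ∑ i, r i * ((c i : ℝ) / (T : ℝ)), ?_⟩
  rintro R ⟨x0, x, hx, rfl⟩
  gcongr with i _
  · exact (hr i).le
  · exact hx.2 i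

/-- Strict capacity and MNL constraints survive a small move in any direction that
keeps the total probability equal to one. -/
theorem exists_pos_perturbation_le {n : ℕ} (v b x z : Fin n → ℝ) (x0 : ℝ)
    (hb : ∀ i, x i < b i) (hv : ∀ i, x i < v i * x0) :
    ∃ ε : ℝ, 0 < ε ∧ ∀ i, x i + ε * z i ≤ b i ∧
      x i + ε * z i ≤ v i * (x0 - ε * ∑ j, z j) := by
  have key : ∀ᶠ ε : ℝ in nhds 0, ∀ i, x i + ε * z i < b i ∧
      x i + ε * z i < v i * (x0 - ε * ∑ j, z j) := by
    refine Filter.eventually_all.2 fun i => Filter.Eventually.and ?_ ?_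
    · exact (by fun_prop : Continuous fun ε : ℝ => x i + ε * z i).continuousAt.eventually_lt
        continuousAt_const (by simpa using hb i)
    · exact (by fun_prop : Continuous fun ε : ℝ => x i + ε * z i).continuousAt.eventually_lt
        (by fun_prop : Continuous fun ε : ℝ => v i * (x0 - ε * ∑ j, z j)).continuousAt
        (by simpa using hv i)
  obtain ⟨ε, hε, hpos⟩ :=
    ((key.filter_mono nhdsWithin_le_nhds).and (self_mem_nhdsWithin (s := Set.Ioi (0 : ℝ)))).exists
  exact ⟨ε, hpos, fun i => ⟨(hε i).1.le, (hε i).2.le⟩⟩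

/-- A balanced vector admits a nonzero nonnegative direction along which it stays balanced. -/
theorem exists_balanced_direction {n : ℕ} (hn : 1 ≤ n) (α : ℝ) (hα : α ≤ 1)
    (x : Fin n → ℝ) (hx : ∀ i, 0 ≤ x i) (hbal : ∀ i, x i = 0 ∨ ∀ j, α * x j ≤ x i) :
    ∃ z : Fin n → ℝ, (∀ i, 0 ≤ z i) ∧ (∃ i, 0 < z i) ∧
      ∀ ε : ℝ, 0 < ε → ∀ i, x i + ε * z i = 0 ∨
        ∀ j, α * (x j + ε * z j) ≤ x i + ε * z i := by
  by_cases h : ∃ i, 0 < x i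
  · refine ⟨x, hx, h, fun ε hε i => ?_⟩
    rcases hbal i with hi | hi
    · exact .inl (by simp [hi])
    · refine .inr fun j => ?_
      linarith [hi j, mul_le_mul_of_nonneg_left (hi j) hε.le]
  · have hzero : ∀ i, x i = 0 := fun i =>
      le_antisymm (not_lt.1 fun hi => h ⟨i, hi⟩) (hx i)
    refine ⟨fun _ => 1, fun _ => zero_le_one, ⟨⟨0, hn⟩, one_pos⟩, fun ε hε i => .inr fun j => ?_⟩
    simpa [hzero] using mul_le_of_le_one_left hε.le hα

/-- every optimal solution of the Upper-Bound problem has some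
product `i` for which either the inventory constraint `x i = c i / T` or the
MNL constraint `x i = v i * x0` is tight. -/
theorem stmt_13 (n : ℕ) (hn : 1 ≤ n) (r v : Fin n → ℝ)
    (hr : ∀ i, 0 < r i) (hv : ∀ i, 0 < v i)
    (α : ℝ) (hα0 : 0 < α) (hα1 : α ≤ 1)
    (T : ℕ) (hT : 0 < T) (c : Fin n → ℕ) (hc : ∀ i, 0 < c i)
    (x0 : ℝ) (x : Fin n → ℝ)
    (hfeas : UBFeasible n v α T c x0 x)
    (hopt : (T : ℝ) * ∑ i, r i * x i = UBopt n r v α T c) :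
    ∃ i, x i = (c i : ℝ) / (T : ℝ) ∨ x i = v i * x0 := by
  by_contra! hne
  obtain ⟨⟨hsum, hbd, hbal⟩, hcap⟩ := hfeas
  obtain ⟨z, hz, ⟨k, hk⟩, hzbal⟩ :=
    exists_balanced_direction hn α hα1 x (fun i => (hbd i).1) hbal
  obtain ⟨ε, hε, hle⟩ := exists_pos_perturbation_le v (fun i => (c i : ℝ) / (T : ℝ)) x z x0
    (fun i => (hcap i).lt_of_ne (hne i).1) (fun i => (hbd i).2.lt_of_ne (hne i).2)
  have hfeas' : UBFeasible n v α T c (x0 - ε * ∑ j, z j) (fun i => x i + ε * z i) := by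
    refine ⟨⟨?_, fun i => ⟨?_, (hle i).2⟩, hzbal ε hε⟩, fun i => (hle i).1⟩
    · rw [Finset.sum_add_distrib, ← Finset.mul_sum]
      linarith
    · exact add_nonneg (hbd i).1 (mul_nonneg hε.le (hz i))
  have hub := le_csSup (bddAbove_UBFeasible_values n r v hr α T c) ⟨_, _, hfeas', rfl⟩
  have hlt : ∑ i, r i * x i < ∑ i, r i * (x i + ε * z i) := by
    refine Finset.sum_lt_sum (fun i _ => ?_) ⟨k, Finset.mem_univ k, ?_⟩
    · exact mul_le_mul_of_nonneg_left
        (le_add_of_nonneg_right (mul_nonneg hε.le (hz i))) (hr i).le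
    · exact mul_lt_mul_of_pos_left (lt_add_of_pos_right _ (mul_pos hε hk)) (hr k)
  have hlt' := mul_lt_mul_of_pos_left hlt (Nat.cast_pos.2 hT : (0 : ℝ) < T)
  exact absurd (hlt'.trans_le hub) (by rw [hopt]; exact lt_irrefl _)
end
end

section
/- Fix n ≥ 1, revenues r_i > 0, MNL preference weights v_i > 0, a horizon T ∈ ℤ⁺, inventories c_i ∈ ℤ⁺, and balancing parameter α = 1. Then there exist x̄ ∈ {c_i/T : i ∈ {1,…,n}} ∪ {v_i/(1+ℓ·v_i) : i ∈ {1,…,n}, ℓ ∈ {1,…,n}}, an integer k ∈ {1,…,n} with k·x̄ < 1, and a UB-feasible vector x* attaining the optimal value of the Upper-Bound problem, such that: x*_i ∈ {0, x̄} for all i; the support A = {i : x*_i > 0} has |A| = k; A ⊆ S(x̄,k) where S(x̄,k) = {i ∈ {1,…,n} : c_i ≥ T·x̄ and v_i ≥ x̄/(1−k·x̄)}; and A consists of k products of S(x̄,k) with the highest revenues, i.e., r_i ≥ r_j for every i ∈ A and every j ∈ S(x̄,k) \ A. -/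
open Classical Finset

noncomputable section

/-- The largest purchase probability product `i` can have when `k` products share it. -/
def probCap {n : ℕ} (v : Fin n → ℝ) (T : ℕ) (c : Fin n → ℕ) (k : ℕ) (i : Fin n) : ℝ :=
  min ((c i : ℝ) / (T : ℝ)) (v i / (1 + (k : ℝ) * v i))

/-- The largest common purchase probability of the products in `A`. -/
def commonProb {n : ℕ} (v : Fin n → ℝ) (T : ℕ) (c : Fin n → ℕ) (A : Finset (Fin n)) : ℝ :=
  if h : A.Nonempty then A.inf' h (probCap v T c A.card) else 0

section

variable {n : ℕ} {r v : Fin n → ℝ} {T : ℕ} {c : Fin n → ℕ}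

lemma le_div_one_add_mul_iff {y w k : ℝ} (hw : 0 < w) (hk : 0 ≤ k) :
    y ≤ w / (1 + k * w) ↔ y ≤ w * (1 - k * y) := by
  rw [le_div_iff₀ (by positivity)]
  constructor <;> intro h <;> linarith

lemma le_probCap_iff (hv : ∀ i, 0 < v i) {k : ℕ} {i : Fin n} {y : ℝ} :
    y ≤ probCap v T c k i ↔ y ≤ (c i : ℝ) / (T : ℝ) ∧ y ≤ v i * (1 - (k : ℝ) * y) := by
  rw [probCap, le_min_iff, le_div_one_add_mul_iff (hv i) (Nat.cast_nonneg k)]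

lemma probCap_pos (hv : ∀ i, 0 < v i) (hT : 0 < T) (hc : ∀ i, 0 < c i) (k : ℕ) (i : Fin n) :
    0 < probCap v T c k i := by
  have h1 : (0 : ℝ) < T := by exact_mod_cast hT
  have h2 : (0 : ℝ) < c i := by exact_mod_cast hc i
  have h3 := hv i
  exact lt_min (by positivity) (by positivity)

lemma commonProb_pos (hv : ∀ i, 0 < v i) (hT : 0 < T) (hc : ∀ i, 0 < c i)
    {A : Finset (Fin n)} (hA : A.Nonempty) : 0 < commonProb v T c A := by
  rw [commonProb, dif_pos hA, Finset.lt_inf'_iff]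
  exact fun i _ => probCap_pos hv hT hc _ i

lemma commonProb_le {A : Finset (Fin n)} {i : Fin n} (hi : i ∈ A) :
    commonProb v T c A ≤ probCap v T c A.card i := by
  rw [commonProb, dif_pos ⟨i, hi⟩]
  exact Finset.inf'_le _ hi

lemma le_commonProb {A : Finset (Fin n)} (hA : A.Nonempty) {y : ℝ}
    (h : ∀ i ∈ A, y ≤ probCap v T c A.card i) : y ≤ commonProb v T c A := by
  rw [commonProb, dif_pos hA]
  exact Finset.le_inf' _ _ h

lemma exists_probCap_eq_commonProb {A : Finset (Fin n)} (hA : A.Nonempty) :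
    ∃ i ∈ A, commonProb v T c A = probCap v T c A.card i := by
  rw [commonProb, dif_pos hA]
  exact Finset.exists_mem_eq_inf' hA _

lemma card_mul_commonProb_lt_one (hv : ∀ i, 0 < v i) (hT : 0 < T) (hc : ∀ i, 0 < c i)
    (A : Finset (Fin n)) : (A.card : ℝ) * commonProb v T c A < 1 := by
  rcases A.eq_empty_or_nonempty with rfl | hA
  · simp
  obtain ⟨i, hi⟩ := hA
  have h := ((le_probCap_iff hv).1 (commonProb_le (v := v) (T := T) (c := c) hi)).2
  have h0 := commonProb_pos hv hT hc ⟨i, hi⟩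
  have h1 := pos_of_mul_pos_right (h0.trans_le h) (hv i).le
  linarith

/-- The vector giving every product of `A` the probability `commonProb v T c A` is feasible. -/
lemma ubFeasible_commonProb (hv : ∀ i, 0 < v i) (hT : 0 < T) (hc : ∀ i, 0 < c i)
    (A : Finset (Fin n)) :
    UBFeasible n v 1 T c (1 - (A.card : ℝ) * commonProb v T c A)
      (fun i => if i ∈ A then commonProb v T c A else 0) := by
  have h1 := card_mul_commonProb_lt_one hv hT hc A
  refine ⟨⟨by simp, fun i => ?_, fun i => ?_⟩, fun i => ?_⟩ <;> by_cases hi : i ∈ A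
  · have h := (le_probCap_iff hv).1 (commonProb_le (v := v) (T := T) (c := c) hi)
    simpa [hi] using ⟨(commonProb_pos hv hT hc ⟨i, hi⟩).le, h.2⟩
  · simpa [hi] using mul_nonneg (hv i).le (sub_nonneg.2 h1.le)
  · right
    intro j
    have h0 := commonProb_pos hv hT hc ⟨i, hi⟩
    by_cases hj : j ∈ A <;> simp [hi, hj, h0.le]
  · simp [hi]
  · simpa [hi] using ((le_probCap_iff hv).1 (commonProb_le (v := v) (T := T) (c := c) hi)).1
  · simp only [hi, if_false]
    positivity

lemma sum_le_of_ubFeasible (hr : ∀ i, 0 < r i) (hv : ∀ i, 0 < v i) {x0 : ℝ} {x : Fin n → ℝ}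
    (h : UBFeasible n v 1 T c x0 x) :
    ∑ i, r i * x i ≤ commonProb v T c (suppF n x) * ∑ i ∈ suppF n x, r i := by
  obtain ⟨⟨hsum, hbd, hbal⟩, hcap⟩ := h
  have hmem : ∀ i, i ∈ suppF n x ↔ 0 < x i := by simp [suppF]
  have hz : ∀ i, i ∉ suppF n x → x i = 0 := fun i hi =>
    le_antisymm (not_lt.1 fun h => hi ((hmem i).2 h)) (hbd i).1
  have hsupp : ∀ f : Fin n → ℝ, ∑ i, f i * x i = ∑ i ∈ suppF n x, f i * x i := fun f =>
    (Finset.sum_subset (Finset.subset_univ _) fun i _ hi => by rw [hz i hi, mul_zero]).symm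
  have hle : ∀ i ∈ suppF n x, ∀ j, x j ≤ x i := fun i hi j => by
    simpa using (hbal i).resolve_left ((hmem i).1 hi).ne' j
  rw [hsupp, Finset.mul_sum]
  refine Finset.sum_le_sum fun i hi => ?_
  rw [mul_comm]
  refine mul_le_mul_of_nonneg_right (le_commonProb ⟨i, hi⟩ fun j hj => ?_) (hr i).le
  have hij : x i = x j := le_antisymm (hle j hj i) (hle i hi j)
  have hx0 : x0 = 1 - ((suppF n x).card : ℝ) * x j := by
    have h1 := hsupp fun _ => 1
    simp only [one_mul] at h1
    rw [Finset.sum_congr rfl fun l hl => le_antisymm (hle j hj l) (hle l hl j),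
      Finset.sum_const, nsmul_eq_mul] at h1
    linarith
  rw [le_probCap_iff hv, hij, ← hx0]
  exact ⟨hcap j, (hbd j).2⟩

end

/-- structure of the Upper-Bound problem when `α = 1`: there is
an optimal solution whose nonzero coordinates all equal a common value `x̄`
drawn from `{c_i/T} ∪ {v_i/(1+ℓ·v_i)}`, whose support has size `k` with
`k·x̄ < 1`, is contained in `S(x̄,k)`, and consists of `k` highest-revenue
products of `S(x̄,k)`. -/
theorem stmt_14 (n : ℕ) (hn : 1 ≤ n) (r v : Fin n → ℝ)
    (hr : ∀ i, 0 < r i) (hv : ∀ i, 0 < v i)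
    (T : ℕ) (hT : 0 < T) (c : Fin n → ℕ) (hc : ∀ i, 0 < c i) :
    ∃ xbar : ℝ,
      ((∃ i, xbar = (c i : ℝ) / (T : ℝ)) ∨
        (∃ i, ∃ ℓ : ℕ, 1 ≤ ℓ ∧ ℓ ≤ n ∧ xbar = v i / (1 + (ℓ : ℝ) * v i))) ∧
      ∃ k : ℕ, 1 ≤ k ∧ k ≤ n ∧ (k : ℝ) * xbar < 1 ∧
        ∃ x0 : ℝ, ∃ x : Fin n → ℝ,
          UBFeasible n v 1 T c x0 x ∧
          (T : ℝ) * ∑ i, r i * x i = UBopt n r v 1 T c ∧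
          (∀ i, x i = 0 ∨ x i = xbar) ∧
          (suppF n x).card = k ∧
          (∀ i ∈ suppF n x,
            (T : ℝ) * xbar ≤ (c i : ℝ) ∧ xbar / (1 - (k : ℝ) * xbar) ≤ v i) ∧
          (∀ i ∈ suppF n x, ∀ j : Fin n,
            ((T : ℝ) * xbar ≤ (c j : ℝ) ∧ xbar / (1 - (k : ℝ) * xbar) ≤ v j) →
            j ∉ suppF n x → r j ≤ r i) := by
  obtain ⟨A, -, hmax⟩ := Finset.exists_max_image Finset.univ
    (fun A : Finset (Fin n) => commonProb v T c A * ∑ i ∈ A, r i) Finset.univ_nonempty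
  have hTpos : (0 : ℝ) < T := by exact_mod_cast hT
  have hA : A.Nonempty := by
    rw [Finset.nonempty_iff_ne_empty]
    rintro rfl
    have h := hmax {⟨0, hn⟩} (Finset.mem_univ _)
    have h1 := commonProb_pos hv hT hc (Finset.singleton_nonempty (⟨0, hn⟩ : Fin n))
    have h2 := mul_pos h1 (hr ⟨0, hn⟩)
    simp only [Finset.sum_empty, mul_zero, Finset.sum_singleton] at h
    linarith
  have hpos := commonProb_pos hv hT hc hA
  have hlt := card_mul_commonProb_lt_one hv hT hc A
  have hcardn : A.card ≤ n := by simpa using Finset.card_le_univ A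
  have hS : ∀ j : Fin n, ((T : ℝ) * commonProb v T c A ≤ (c j : ℝ) ∧
      commonProb v T c A / (1 - (A.card : ℝ) * commonProb v T c A) ≤ v j) ↔
      commonProb v T c A ≤ probCap v T c A.card j := fun j => by
    rw [le_probCap_iff hv, le_div_iff₀ hTpos, div_le_iff₀ (sub_pos.2 hlt), mul_comm (T : ℝ)]
  have hfeas := ubFeasible_commonProb hv hT hc A
  have hsupp : suppF n (fun i => if i ∈ A then commonProb v T c A else 0) = A := by
    ext i
    by_cases hi : i ∈ A <;> simp [suppF, hi, hpos]
  have hval : ∑ i, r i * (if i ∈ A then commonProb v T c A else 0) =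
      commonProb v T c A * ∑ i ∈ A, r i := by
    simp [Finset.mul_sum, mul_comm]
  refine ⟨commonProb v T c A, ?_, A.card, hA.card_pos, hcardn, hlt, _, _, hfeas, ?_,
    fun i => ?_, by rw [hsupp], ?_, ?_⟩
  · obtain ⟨i, -, hi⟩ := exists_probCap_eq_commonProb (v := v) (T := T) (c := c) hA
    rw [hi]
    rcases min_choice ((c i : ℝ) / (T : ℝ)) (v i / (1 + (A.card : ℝ) * v i)) with h | h
    · exact Or.inl ⟨i, h⟩
    · exact Or.inr ⟨i, A.card, hA.card_pos, hcardn, h⟩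
  · refine Eq.symm (IsGreatest.csSup_eq (And.intro ⟨_, _, hfeas, rfl⟩ ?_))
    rintro _ ⟨x0, x, hx, rfl⟩
    rw [hval]
    exact mul_le_mul_of_nonneg_left
      ((sum_le_of_ubFeasible hr hv hx).trans (hmax _ (Finset.mem_univ _))) hTpos.le
  · by_cases hi : i ∈ A <;> simp [hi]
  · rw [hsupp]
    exact fun i hi => (hS i).2 (commonProb_le hi)
  · rw [hsupp]
    intro i hi j hj hjA
    rw [hS] at hj
    by_contra! hij
    have hjE : j ∉ A.erase i := fun h => hjA (Finset.mem_of_mem_erase h)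
    have hcard : (insert j (A.erase i)).card = A.card := by
      rw [Finset.card_insert_of_notMem hjE, Finset.card_erase_add_one hi]
    have hle : commonProb v T c A ≤ commonProb v T c (insert j (A.erase i)) := by
      refine le_commonProb (Finset.insert_nonempty _ _) fun l hl => ?_
      rw [hcard]
      rcases Finset.mem_insert.1 hl with rfl | hl
      · exact hj
      · exact commonProb_le (Finset.mem_of_mem_erase hl)
    have hsum : ∑ l ∈ A, r l < ∑ l ∈ insert j (A.erase i), r l := by
      rw [Finset.sum_insert hjE, ← Finset.add_sum_erase A r hi]
      linarith
    have hnonneg : 0 ≤ ∑ l ∈ insert j (A.erase i), r l :=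
      Finset.sum_nonneg fun l _ => (hr l).le
    exact absurd (hmax (insert j (A.erase i)) (Finset.mem_univ _)) (not_le.2
      ((mul_lt_mul_of_pos_left hsum hpos).trans_le (mul_le_mul_of_nonneg_right hle hnonneg)))
end
end

section
/- Let T be a positive integer and c a positive integer, and for p ∈ [0,1] let G(p,c) = ∑_{k=0}^T min(k,c)·C(T,k)·p^k·(1−p)^{T−k} be the expectation of min(Z,c) for a binomial random variable Z with T trials and success probability p. Then for all p₁, p₂ with 0 < p₂ ≤ p₁ < 1, one has 0 ≤ G(p₁,c) − G(p₂,c) ≤ T·(p₁ − p₂); that is, p ↦ G(p,c) is monotonically increasing and T-Lipschitz on (0,1). -/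
open Classical Finset

noncomputable section

/-- `G T c p` is the expected value of `min(Z, c)` where `Z` is a binomial
random variable with `T` trials and success probability `p`. -/
def G (T c : ℕ) (p : ℝ) : ℝ :=
  ∑ k ∈ Finset.range (T + 1),
    ((min k c : ℕ) : ℝ) * (T.choose k : ℝ) * p ^ k * (1 - p) ^ (T - k)

/-- The expectation of `f Z` for a binomial random variable `Z` with `T` trials and success
probability `p`. -/
def binomialMean (T : ℕ) (f : ℕ → ℝ) (p : ℝ) : ℝ :=
  ∑ k ∈ range (T + 1), (T.choose k : ℝ) * (f k * p ^ k * (1 - p) ^ (T - k))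

theorem binomialMean_succ (T : ℕ) (f : ℕ → ℝ) (p : ℝ) :
    binomialMean (T + 1) f p =
      p * binomialMean T (fun k => f (k + 1)) p + (1 - p) * binomialMean T f p := by
  unfold binomialMean
  rw [Finset.sum_choose_succ_mul (fun i j => f i * p ^ i * (1 - p) ^ j), add_comm,
    mul_sum, mul_sum]
  congr 1
  · refine sum_congr rfl fun k _ => ?_
    ring
  · refine sum_congr rfl fun k hk => ?_
    rw [Nat.succ_sub (Nat.lt_succ_iff.mp (mem_range.mp hk)), pow_succ]
    ring

theorem binomialMean_const (T : ℕ) (a p : ℝ) : binomialMean T (fun _ => a) p = a := by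
  induction T with
  | zero => simp [binomialMean]
  | succ T ih => rw [binomialMean_succ, ih]; ring

theorem binomialMean_add (T : ℕ) (f g : ℕ → ℝ) (p : ℝ) :
    binomialMean T (fun k => f k + g k) p = binomialMean T f p + binomialMean T g p := by
  simp only [binomialMean, ← sum_add_distrib]
  exact sum_congr rfl fun k _ => by ring

theorem binomialMean_mono (T : ℕ) {f g : ℕ → ℝ} (h : ∀ k, f k ≤ g k) {p : ℝ}
    (hp₀ : 0 ≤ p) (hp₁ : p ≤ 1) : binomialMean T f p ≤ binomialMean T g p := by
  have hq : 0 ≤ 1 - p := sub_nonneg.mpr hp₁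
  unfold binomialMean
  gcongr with k
  exact h k

/-- If `f` is monotone with increments at most `1`, then its binomial mean is monotone and
`T`-Lipschitz in the success probability. -/
theorem binomialMean_sub_mem_Icc (T : ℕ) {p₁ p₂ : ℝ} (hp₂ : 0 ≤ p₂) (hle : p₂ ≤ p₁)
    (hp₁ : p₁ ≤ 1) (f : ℕ → ℝ) (hmono : ∀ k, f k ≤ f (k + 1)) (hincr : ∀ k, f (k + 1) ≤ f k + 1) :
    binomialMean T f p₁ - binomialMean T f p₂ ∈ Set.Icc 0 (T * (p₁ - p₂)) := by
  induction T generalizing f with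
  | zero => simp [binomialMean]
  | succ T ih =>
    obtain ⟨hf₀, hf₁⟩ := ih f hmono hincr
    obtain ⟨hs₀, hs₁⟩ := ih (fun k => f (k + 1)) (fun k => hmono (k + 1)) (fun k => hincr (k + 1))
    have hlow := binomialMean_mono T hmono hp₂ (hle.trans hp₁)
    have hupp := binomialMean_mono T hincr hp₂ (hle.trans hp₁)
    rw [binomialMean_add, binomialMean_const] at hupp
    have hp : 0 ≤ p₁ := hp₂.trans hle
    have hq : 0 ≤ 1 - p₁ := sub_nonneg.mpr hp₁
    have hd : 0 ≤ p₁ - p₂ := sub_nonneg.mpr hle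
    rw [binomialMean_succ, binomialMean_succ, Set.mem_Icc]
    push_cast
    constructor
    · linarith [mul_nonneg hp hs₀, mul_nonneg hq hf₀, mul_nonneg hd (sub_nonneg.mpr hlow)]
    · linarith [mul_le_mul_of_nonneg_left hs₁ hp, mul_le_mul_of_nonneg_left hf₁ hq,
        mul_le_mul_of_nonneg_left hupp hd]

theorem G_eq_binomialMean (T c : ℕ) (p : ℝ) :
    G T c p = binomialMean T (fun k => ((min k c : ℕ) : ℝ)) p :=
  sum_congr rfl fun k _ => by ring

/-- `p ↦ G(p,c)` is monotonically increasing and `T`-Lipschitz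
on `(0,1)`. -/
theorem stmt_16 (T c : ℕ) (hT : 0 < T) (hc : 0 < c)
    (p₁ p₂ : ℝ) (hp₂ : 0 < p₂) (hle : p₂ ≤ p₁) (hp₁ : p₁ < 1) :
    0 ≤ G T c p₁ - G T c p₂ ∧ G T c p₁ - G T c p₂ ≤ (T : ℝ) * (p₁ - p₂) := by
  simp only [G_eq_binomialMean]
  refine binomialMean_sub_mem_Icc T hp₂.le hle hp₁.le _ (fun k => ?_) (fun k => ?_)
  · exact_mod_cast min_le_min_right c k.le_succ
  · exact_mod_cast (by omega : min (k + 1) c ≤ min k c + 1)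
end
end

section
/- Fix n ≥ 1, revenues r_i > 0, MNL preference weights v_i > 0, a balancing parameter α ∈ (0,1), a horizon T ∈ ℤ⁺, inventories c_i ∈ ℤ⁺, and ε₂ ∈ (0, 1−α]. Let x̃ be a UB-feasible vector whose support S̄ = {i : x̃_i > 0} is nonempty, let G_min = min_{i∈S̄} G(x̃_i, c_i), and let c_min = min_{i∈{1,…,n}} c_i. Suppose x̂ ∈ [0,1]^n satisfies: x̂_i = 0 for all i ∉ S̄; for i ∈ S̄ with G(x̃_i,c_i) ≤ G_min/α, x̂_i = x̃_i; and for i ∈ S̄ with G(x̃_i,c_i) > G_min/α, (1−ε₂)·G_min/α ≤ G(x̂_i,c_i) ≤ G_min/α. Then (a) G_min ≤ G(x̂_i,c_i) ≤ G_min/α for every i ∈ S̄, and (b) ∑_{i∈S̄} r_i·G(x̂_i,c_i) ≥ (1−ε₂)·max{1/2, 1 − 1/√c_min}·T·∑_{i=1}^n r_i·x̃_i. -/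
open Classical Finset

noncomputable section

/-- The weights of the binomial distribution sum to one, have mean `T * p` and variance
`T * p * (1 - p)`. -/
theorem binomial_moments (T : ℕ) (p : ℝ) :
    ∑ k ∈ range (T + 1), (T.choose k : ℝ) * p ^ k * (1 - p) ^ (T - k) = 1 ∧
    ∑ k ∈ range (T + 1), (k : ℝ) * ((T.choose k : ℝ) * p ^ k * (1 - p) ^ (T - k)) = T * p ∧
    ∑ k ∈ range (T + 1), ((T : ℝ) * p - k) ^ 2 *
      ((T.choose k : ℝ) * p ^ k * (1 - p) ^ (T - k)) = T * p * (1 - p) := by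
  have h0 := congrArg (Polynomial.eval p) (bernsteinPolynomial.sum ℝ T)
  have h1 := congrArg (Polynomial.eval p) (bernsteinPolynomial.sum_smul ℝ T)
  have h2 := congrArg (Polynomial.eval p) (bernsteinPolynomial.variance ℝ T)
  simp only [Polynomial.eval_finsetSum, bernsteinPolynomial, Polynomial.eval_mul,
    Polynomial.eval_pow, Polynomial.eval_sub, Polynomial.eval_X, Polynomial.eval_one,
    Polynomial.eval_natCast, nsmul_eq_mul] at h0 h1 h2
  exact ⟨h0, h1, h2⟩

theorem min_ge_sub_sq_div (k c s : ℝ) (hs : 0 < s) :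
    k - (k - c + s) ^ 2 / (4 * s) ≤ min k c := by
  rw [sub_le_comm, le_div_iff₀ (by positivity)]
  rcases le_total k c with h | h
  · rw [min_eq_left h]
    nlinarith [sq_nonneg (k - c + s)]
  · rw [min_eq_right h]
    nlinarith [sq_nonneg (k - c - s)]

theorem G_nonneg (T c : ℕ) (p : ℝ) (hp0 : 0 ≤ p) (hp1 : p ≤ 1) : 0 ≤ G T c p := by
  have h : 0 ≤ 1 - p := sub_nonneg.2 hp1
  exact sum_nonneg fun k _ => by positivity

/-- Scarf-type bound on the expected truncated binomial, with a free parameter `s`. -/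
theorem G_ge_of_pos (T c : ℕ) (p s : ℝ) (hp0 : 0 ≤ p) (hp1 : p ≤ 1) (hs : 0 < s) :
    T * p - (T * p * (1 - p) + (T * p - c + s) ^ 2) / (4 * s) ≤ G T c p := by
  obtain ⟨h0, h1, h2⟩ := binomial_moments T p
  have hp : 0 ≤ 1 - p := sub_nonneg.2 hp1
  set w : ℕ → ℝ := fun k => (T.choose k : ℝ) * p ^ k * (1 - p) ^ (T - k) with hw
  have key : ∑ k ∈ range (T + 1), ((k : ℝ) - ((k : ℝ) - c + s) ^ 2 / (4 * s)) * w k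
      ≤ G T c p := by
    refine sum_le_sum fun k _ => ?_
    have hwk : 0 ≤ w k := by simp only [hw]; positivity
    have := mul_le_mul_of_nonneg_right (min_ge_sub_sq_div k c s hs) hwk
    simpa only [hw, Nat.cast_min, mul_assoc] using this
  refine le_trans (le_of_eq ?_) key
  set e : ℝ := T * p - c + s with he
  have hsplit : ∀ k : ℕ, ((k : ℝ) - ((k : ℝ) - c + s) ^ 2 / (4 * s)) * w k =
      (1 - 2 * e / (4 * s)) * (k * w k) - 1 / (4 * s) * (((T : ℝ) * p - k) ^ 2 * w k)
        + (2 * e * (T * p) - e ^ 2) / (4 * s) * w k := by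
    intro k
    have : (k : ℝ) - c + s = k - T * p + e := by rw [he]; ring
    rw [this]
    field_simp
    ring
  rw [sum_congr rfl fun k _ => hsplit k, sum_add_distrib, sum_sub_distrib, ← mul_sum,
    ← mul_sum, ← mul_sum, h0, h1, h2]
  field_simp
  ring

/-- If the mean demand does not exceed the inventory `c`, truncating at `c` loses at most a
fraction `1 / (2 * √c)` of the mean. -/
theorem G_ge_mean (T c : ℕ) (p : ℝ) (hp0 : 0 ≤ p) (hp1 : p ≤ 1) (hc : 0 < c)
    (hle : T * p ≤ c) : (1 - 1 / (2 * √(c : ℝ))) * (T * p) ≤ G T c p := by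
  have hμ0 : 0 ≤ (T : ℝ) * p := by positivity
  rcases hμ0.eq_or_lt with hμ | hμ
  · rw [← hμ, mul_zero]
    exact G_nonneg T c p hp0 hp1
  have hc1 : (1 : ℝ) ≤ c := by exact_mod_cast hc
  set d : ℝ := c - T * p with hd
  have hd0 : 0 ≤ d := sub_nonneg.2 hle
  set s : ℝ := √(T * p + d ^ 2) with hs
  have hspos : 0 < s := Real.sqrt_pos.2 (by positivity)
  have hs2 : s ^ 2 = T * p + d ^ 2 := Real.sq_sqrt (by positivity)
  have hr : 0 < √(c : ℝ) := Real.sqrt_pos.2 (by positivity)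
  have hhalf : 1 / 2 ≤ s := by
    refine Real.le_sqrt_of_sq_le ?_
    nlinarith [sq_nonneg (d - 1 / 2)]
  have hrs : √(c : ℝ) ≤ s + d := by
    rw [Real.sqrt_le_left (by positivity)]
    nlinarith [mul_nonneg hd0 (sub_nonneg.2 hhalf), sq_nonneg d]
  have hloss : s - d ≤ T * p / √(c : ℝ) := by
    rw [le_div_iff₀ hr]
    have hsd : 0 ≤ s - d := by
      have : d ≤ s := Real.le_sqrt_of_sq_le (by linarith)
      linarith
    nlinarith [mul_le_mul_of_nonneg_left hrs hsd]
  refine le_trans ?_ (G_ge_of_pos T c p s hp0 hp1 hspos)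
  have hq : (T * p * (1 - p) + (T * p - c + s) ^ 2) / (4 * s) ≤ (s - d) / 2 := by
    rw [div_le_iff₀ (by positivity)]
    have : (T : ℝ) * p - c + s = s - d := by rw [hd]; ring
    rw [this]
    nlinarith [mul_nonneg hμ0 hp0]
  have : (1 - 1 / (2 * √(c : ℝ))) * (T * p) = T * p - T * p / √(c : ℝ) / 2 := by
    field_simp
  linarith

/-- key guarantee behind Theorem 3: the purchase probabilities
`x̂` constructed by Algorithm 2 from a UB-feasible `x̃` satisfy the market
share balancing condition on expected sales, and lose at most a factor
`(1−ε₂)·max{1/2, 1 − 1/√c_min}` of the fluid revenue. -/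
theorem stmt_17 (n : ℕ) (hn : 1 ≤ n) (r v : Fin n → ℝ)
    (hr : ∀ i, 0 < r i) (hv : ∀ i, 0 < v i)
    (α : ℝ) (hα0 : 0 < α) (hα1 : α < 1)
    (T : ℕ) (hT : 0 < T) (c : Fin n → ℕ) (hc : ∀ i, 0 < c i)
    (ε₂ : ℝ) (hε₂ : 0 < ε₂) (hε₂' : ε₂ ≤ 1 - α)
    (x0 : ℝ) (xt : Fin n → ℝ) (hfeas : UBFeasible n v α T c x0 xt)
    (hne : (suppF n xt).Nonempty)
    (Gmin : ℝ)
    (hGmin : IsLeast {g : ℝ | ∃ i ∈ suppF n xt, G T (c i) (xt i) = g} Gmin)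
    (cmin : ℕ) (hcmin : IsLeast {k : ℕ | ∃ i, c i = k} cmin)
    (xh : Fin n → ℝ) (hxh01 : ∀ i, 0 ≤ xh i ∧ xh i ≤ 1)
    (hxh0 : ∀ i, i ∉ suppF n xt → xh i = 0)
    (hxh1 : ∀ i ∈ suppF n xt, G T (c i) (xt i) ≤ Gmin / α → xh i = xt i)
    (hxh2 : ∀ i ∈ suppF n xt, Gmin / α < G T (c i) (xt i) →
      (1 - ε₂) * Gmin / α ≤ G T (c i) (xh i) ∧ G T (c i) (xh i) ≤ Gmin / α) :
    (∀ i ∈ suppF n xt, Gmin ≤ G T (c i) (xh i) ∧ G T (c i) (xh i) ≤ Gmin / α) ∧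
    (1 - ε₂) * max (1 / 2 : ℝ) (1 - 1 / Real.sqrt (cmin : ℝ)) *
        ((T : ℝ) * ∑ i, r i * xt i) ≤
      ∑ i ∈ suppF n xt, r i * G T (c i) (xh i) := by
  obtain ⟨⟨hsum, hbd, hbal⟩, hcap⟩ := hfeas
  have hTpos : (0 : ℝ) < T := by exact_mod_cast hT
  have hxt1 : ∀ i, xt i ≤ 1 := by
    intro i
    have hx0 : 0 ≤ x0 :=
      nonneg_of_mul_nonneg_right ((hbd i).1.trans (hbd i).2) (hv i)
    have := single_le_sum (fun j _ => (hbd j).1) (mem_univ i)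
    linarith
  set β : ℝ := max (1 / 2 : ℝ) (1 - 1 / √(cmin : ℝ)) with hβ
  have hβ0 : 0 ≤ β := le_trans (by norm_num) (le_max_left _ _)
  have hcmin0 : 0 < cmin := by
    obtain ⟨i, rfl⟩ := hcmin.1
    exact hc i
  have hfluid : ∀ i, β * (T * xt i) ≤ G T (c i) (xt i) := by
    intro i
    have hle : (T : ℝ) * xt i ≤ c i := by
      have := hcap i
      rwa [le_div_iff₀ hTpos, mul_comm] at this
    refine le_trans (mul_le_mul_of_nonneg_right ?_ (mul_nonneg hTpos.le (hbd i).1))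
      (G_ge_mean T (c i) (xt i) (hbd i).1 (hxt1 i) (hc i) hle)
    have hci : (1 : ℝ) ≤ √(c i : ℝ) := Real.one_le_sqrt.2 (by exact_mod_cast hc i)
    have hm : (0 : ℝ) < √(cmin : ℝ) := Real.sqrt_pos.2 (by exact_mod_cast hcmin0)
    have hmc : √(cmin : ℝ) ≤ √(c i : ℝ) :=
      Real.sqrt_le_sqrt (by exact_mod_cast hcmin.2 ⟨i, rfl⟩)
    refine max_le ?_ ?_
    · have : 1 / (2 * √(c i : ℝ)) ≤ 1 / 2 :=
        one_div_le_one_div_of_le (by norm_num) (by linarith)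
      linarith
    · have : 1 / (2 * √(c i : ℝ)) ≤ 1 / √(cmin : ℝ) :=
        one_div_le_one_div_of_le hm (by linarith)
      linarith
  obtain ⟨m, hm, hmG⟩ := hGmin.1
  have hG0 : 0 ≤ Gmin := hmG ▸ G_nonneg T (c m) (xt m) (hbd m).1 (hxt1 m)
  have hε1 : 0 ≤ 1 - ε₂ := by linarith
  refine ⟨fun i hi => ?_, ?_⟩
  · rcases le_or_gt (G T (c i) (xt i)) (Gmin / α) with h | h
    · rw [hxh1 i hi h]
      exact ⟨hGmin.2 ⟨i, hi, rfl⟩, h⟩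
    · obtain ⟨hlo, hup⟩ := hxh2 i hi h
      refine ⟨le_trans ?_ hlo, hup⟩
      rw [le_div_iff₀ hα0]
      nlinarith
  · have hterm : ∀ i ∈ suppF n xt, (1 - ε₂) * (β * (T * xt i)) ≤ G T (c i) (xh i) := by
      intro i hi
      rcases le_or_gt (G T (c i) (xt i)) (Gmin / α) with h | h
      · rw [hxh1 i hi h]
        refine le_trans (mul_le_of_le_one_left ?_ (by linarith)) (hfluid i)
        exact mul_nonneg hβ0 (mul_nonneg hTpos.le (hbd i).1)
      · refine le_trans ?_ (hxh2 i hi h).1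
        rw [mul_div_assoc]
        refine mul_le_mul_of_nonneg_left ?_ hε1
        rw [le_div_iff₀ hα0, ← hmG]
        refine le_trans ?_ (hfluid m)
        have hmpos : 0 < xt m := (mem_filter.1 hm).2
        have hmi : α * xt i ≤ xt m := (hbal m).resolve_left hmpos.ne' i
        have := mul_le_mul_of_nonneg_left hmi (mul_nonneg hβ0 hTpos.le)
        linarith
    have hsupp : ∑ i, r i * xt i = ∑ i ∈ suppF n xt, r i * xt i := by
      refine (sum_subset (subset_univ _) fun i _ hi => ?_).symm
      have : ¬ 0 < xt i := fun h => hi (mem_filter.2 ⟨mem_univ i, h⟩)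
      rw [le_antisymm (not_lt.1 this) (hbd i).1, mul_zero]
    rw [hsupp, mul_sum, mul_sum]
    refine sum_le_sum fun i hi => ?_
    have := mul_le_mul_of_nonneg_left (hterm i hi) (hr i).le
    linarith
end
end

section
/- Let n ≥ 2 be an integer and α ∈ (0,1]. Consider the instance with n products where r_i = 1 for all i, v_1 = α, and v_i = 1 + i·α/n² for i ∈ {2,…,n}. Then the optimal value of the randomized balanced-market-share problem BMS for this instance is (n+α−1)/(n+α), and the unique BMS-feasible vector attaining it is x*_1 = α/(n+α), x*_i = 1/(n+α) for i ∈ {2,…,n}, and x*_0 = 1/(n+α). -/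
open Classical Finset

noncomputable section

/-- A feasible vector has `x0 > 0`, and either every coordinate is bounded by the claimed optimal
multiple of `x0`, or its total market share is strictly below the claimed bound. -/
theorem BMSFeasible.bound {m : ℕ} {α x0 : ℝ} {v x : Fin (m + 1) → ℝ} (hα0 : 0 < α)
    (hv0 : v 0 = α) (hv : ∀ i : Fin m, v i.succ ≤ 1 + α / (m + 1))
    (h : BMSFeasible (m + 1) v α x0 x) :
    0 < x0 ∧ ((x 0 ≤ α * x0 ∧ ∀ i : Fin m, x i.succ ≤ x0) ∨ ∑ i, x i < (m + α) * x0) := by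
  obtain ⟨hsum, hbd, hbal⟩ := h
  have hx0 : 0 < x0 := by
    by_contra! hle
    have hz : x0 = 0 := by
      have h0 := hbd 0
      rw [hv0] at h0
      nlinarith
    have hx : ∀ i, x i = 0 := fun i => by
      have hi := hbd i
      rw [hz, mul_zero] at hi
      exact le_antisymm hi.2 hi.1
    simp [hz, hx] at hsum
  have hfirst : x 0 ≤ α * x0 := hv0 ▸ (hbd 0).2
  refine ⟨hx0, ?_⟩
  rcases hbal 0 with h0 | h0
  · right
    have hle : ∑ i : Fin m, x i.succ ≤ m * ((1 + α / (m + 1)) * x0) := by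
      calc ∑ i : Fin m, x i.succ ≤ ∑ _i : Fin m, (1 + α / (m + 1)) * x0 :=
            Finset.sum_le_sum fun i _ => (hbd i.succ).2.trans
              (mul_le_mul_of_nonneg_right (hv i) hx0.le)
        _ = m * ((1 + α / (m + 1)) * x0) := by simp
    rw [Fin.sum_univ_succ, h0, zero_add]
    refine hle.trans_lt ?_
    have hgap : (m + α) * x0 - m * ((1 + α / (m + 1)) * x0) = α / (m + 1) * x0 := by
      field_simp
      ring
    have : 0 < α / (m + 1) * x0 := by positivity
    linarith
  · exact Or.inl ⟨hfirst, fun i => le_of_mul_le_mul_left ((h0 i.succ).trans hfirst) hα0⟩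

theorem BMSFeasible.sum_le {m : ℕ} {α x0 : ℝ} {v x : Fin (m + 1) → ℝ} (hα0 : 0 < α)
    (hv0 : v 0 = α) (hv : ∀ i : Fin m, v i.succ ≤ 1 + α / (m + 1))
    (h : BMSFeasible (m + 1) v α x0 x) : ∑ i, x i ≤ (m + α) * x0 := by
  obtain ⟨-, ⟨h0, hs⟩ | hlt⟩ := h.bound hα0 hv0 hv
  · have hle : ∑ i : Fin m, x i.succ ≤ ∑ _i : Fin m, x0 := Finset.sum_le_sum fun i _ => hs i
    simp only [sum_const, card_univ, Fintype.card_fin, nsmul_eq_mul] at hle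
    rw [Fin.sum_univ_succ]
    linarith
  · exact hlt.le

theorem BMSFeasible.eq_of_sum_eq {m : ℕ} {α x0 : ℝ} {v x : Fin (m + 1) → ℝ} (hα0 : 0 < α)
    (hv0 : v 0 = α) (hv : ∀ i : Fin m, v i.succ ≤ 1 + α / (m + 1))
    (h : BMSFeasible (m + 1) v α x0 x) (hsum : ∑ i, x i = (m + α) * x0) :
    x 0 = α * x0 ∧ ∀ i : Fin m, x i.succ = x0 := by
  obtain ⟨-, ⟨h0, hs⟩ | hlt⟩ := h.bound hα0 hv0 hv
  · have hle : ∑ i : Fin m, x i.succ ≤ ∑ _i : Fin m, x0 := Finset.sum_le_sum fun i _ => hs i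
    have hconst : ∑ _i : Fin m, x0 = m * x0 := by simp
    rw [Fin.sum_univ_succ] at hsum
    refine ⟨by linarith, fun i => ?_⟩
    exact (Finset.sum_eq_sum_iff_of_le fun i _ => hs i).1 (by linarith) i (Finset.mem_univ i)
  · exact absurd hsum hlt.ne

theorem bmsFeasible_cons {m : ℕ} {α : ℝ} {v : Fin (m + 1) → ℝ} (hα0 : 0 < α) (hα1 : α ≤ 1)
    (hv0 : v 0 = α) (hv : ∀ i : Fin m, 1 ≤ v i.succ) :
    BMSFeasible (m + 1) v α (1 / (m + 1 + α))
      (Fin.cons (α / (m + 1 + α)) fun _ => 1 / (m + 1 + α)) := by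
  have hd : (0 : ℝ) < m + 1 + α := by positivity
  have hc : (0 : ℝ) < 1 / (m + 1 + α) := by positivity
  have hα : α / (m + 1 + α) = α * (1 / (m + 1 + α)) := by ring
  refine ⟨?_, fun i => ?_, fun i => Or.inr fun j => ?_⟩
  · rw [Fin.sum_univ_succ]
    simp only [Fin.cons_zero, Fin.cons_succ, sum_const, card_univ, Fintype.card_fin, nsmul_eq_mul]
    field_simp
    ring
  · refine Fin.cases ?_ (fun i => ?_) i
    · rw [Fin.cons_zero, hv0, hα]
      exact ⟨by positivity, le_rfl⟩
    · rw [Fin.cons_succ]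
      exact ⟨hc.le, le_mul_of_one_le_left hc.le (hv i)⟩
  · rw [hα]
    generalize 1 / ((m : ℝ) + 1 + α) = c at hc
    have hmul : α * c ≤ c := mul_le_of_le_one_left hc.le hα1
    refine Fin.cases ?_ (fun i => ?_) i <;> refine Fin.cases ?_ (fun j => ?_) j <;>
      simp only [Fin.cons_zero, Fin.cons_succ] <;> nlinarith

/-- Example 2: for the instance with `r_i = 1`, `v_1 = α`, and
`v_i = 1 + i·α/n²` for `i ≥ 2`, the optimal value of BMS is
`(n+α−1)/(n+α)`, attained uniquely at `x_1 = α/(n+α)`, `x_i = 1/(n+α)` for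
`i ≥ 2`, `x_0 = 1/(n+α)`. -/
theorem stmt_18 (n : ℕ) (hn : 2 ≤ n) (α : ℝ) (hα0 : 0 < α) (hα1 : α ≤ 1)
    (r v : Fin n → ℝ) (hr : ∀ i, r i = 1)
    (hv1 : v ⟨0, by omega⟩ = α)
    (hvi : ∀ i : Fin n, 1 ≤ i.val →
      v i = 1 + ((i.val + 1 : ℕ) : ℝ) * α / (n : ℝ) ^ 2) :
    Rstar n r v α = ((n : ℝ) + α - 1) / ((n : ℝ) + α) ∧
    ∀ x0 : ℝ, ∀ x : Fin n → ℝ, BMSFeasible n v α x0 x →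
      ∑ i, r i * x i = ((n : ℝ) + α - 1) / ((n : ℝ) + α) →
      x0 = 1 / ((n : ℝ) + α) ∧
      x ⟨0, by omega⟩ = α / ((n : ℝ) + α) ∧
      ∀ i : Fin n, 1 ≤ i.val → x i = 1 / ((n : ℝ) + α) := by
  obtain ⟨m, rfl⟩ : ∃ m, n = m + 1 := ⟨n - 1, by omega⟩
  have hv0 : v 0 = α := hv1
  have hd : (0 : ℝ) < m + 1 + α := by positivity
  have hvs : ∀ i : Fin m, 1 ≤ v i.succ ∧ v i.succ ≤ 1 + α / (m + 1) := fun i => by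
    rw [hvi i.succ (by simp)]
    have hi : ((i.succ.val + 1 : ℕ) : ℝ) ≤ m + 1 := by exact_mod_cast i.succ.isLt
    refine ⟨le_add_of_nonneg_right (by positivity), ?_⟩
    have heq : α / (m + 1) = (m + 1) * α / ((m + 1 : ℕ) : ℝ) ^ 2 := by
      push_cast
      field_simp
    rw [heq]
    gcongr
  have hupper := fun i => (hvs i).2
  simp only [Rstar, hr, one_mul]
  push_cast
  refine ⟨IsGreatest.csSup_eq ⟨⟨_, _, bmsFeasible_cons hα0 hα1 hv0 fun i => (hvs i).1, ?_⟩, ?_⟩,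
    fun x0 x h hopt => ?_⟩
  · rw [Fin.sum_univ_succ]
    simp only [Fin.cons_zero, Fin.cons_succ, sum_const, card_univ, Fintype.card_fin, nsmul_eq_mul]
    field_simp
    ring
  · rintro R ⟨x0, x, h, rfl⟩
    have hle := h.sum_le hα0 hv0 hupper
    rw [le_div_iff₀ hd]
    nlinarith [h.1]
  · have hx0 : x0 = 1 / (m + 1 + α) := by
      rw [eq_sub_of_add_eq h.1, hopt]
      field_simp
      ring
    have hsum : ∑ i, x i = (m + α) * x0 := by
      rw [hopt, hx0]
      ring
    obtain ⟨hfirst, hrest⟩ := h.eq_of_sum_eq hα0 hv0 hupper hsum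
    refine ⟨hx0, ?_, fun i hi => ?_⟩
    · change x 0 = _
      rw [hfirst, hx0, mul_one_div]
    · obtain ⟨j, rfl⟩ := Fin.exists_succ_eq.2 (show i ≠ 0 by rintro rfl; simp at hi)
      rw [hrest j, hx0]
end
end
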